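/- Let μ ∈ ℝ and σ > 0 with m = μ/σ ≠ 0, and for each n let a₀, …, aₙ be independent identically distributed normal real random variables with mean μ and variance σ², and let Eₙ denote the expected number of real zeros of the random polynomial a₀ + a₁x + ⋯ + aₙxⁿ. Then as n → ∞, Eₙ = (1/π)·log n + C₁/2 + 1/2 − γ/π − (2/π)·log|m| + O(1/n), where C₁ = (2/π)·( log 2 + ∫₀^∞ { √( 1/x² − 4e^(−2x)/(1−e^(−2x))² ) − 1/(x+1) } dx ) and γ is Euler's constant. (Theorem 5.3.) -/

import Mathlib

open MeasureTheory ProbabilityTheory Real Set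
open scoped ENNReal NNReal

section AreaFormula

variable {n : ℕ} {f f' : (Fin n → ℝ) → ℝ → ℝ}

/-- The points of the strip over `I` at whose parameter the derivative does not vanish on
`[p, q]`. -/
def monotoneStrip (f' : (Fin n → ℝ) → ℝ → ℝ) (I : ℚ × ℚ) : Set (ℝ × (Fin n → ℝ)) :=
  {z | z.1 ∈ Ioo (I.1 : ℝ) I.2 ∧ ∀ s ∈ Icc (I.1 : ℝ) I.2, f' z.2 s ≠ 0}

lemma measurableSet_monotoneStrip (hf' : Continuous (Function.uncurry f')) (I : ℚ × ℚ) :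
    MeasurableSet (monotoneStrip f' I) := by
  have h : IsOpen {b : Fin n → ℝ | ∀ s ∈ Icc (I.1 : ℝ) I.2, f' b s ≠ 0} := by
    rw [isOpen_iff_mem_nhds]
    intro b hb
    refine isCompact_Icc.eventually_forall_of_forall_eventually fun s hs => ?_
    exact (hf'.isOpen_preimage _ isOpen_compl_singleton).mem_nhds (hb s hs)
  exact (measurableSet_Ioo.preimage measurable_fst).inter (h.measurableSet.preimage measurable_snd)

lemma iUnion_monotoneStrip (hf' : Continuous (Function.uncurry f')) :
    ⋃ I, monotoneStrip f' I = {z | f' z.2 z.1 ≠ 0} := by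
  ext ⟨t, b⟩
  simp only [mem_iUnion, mem_ofPred_eq, monotoneStrip]
  constructor
  · rintro ⟨I, ht, h⟩
    exact h t (Ioo_subset_Icc_self ht)
  · intro h
    have hc : Continuous (f' b) := hf'.comp (by fun_prop : Continuous fun s => (b, s))
    have hn : {s | f' b s ≠ 0} ∈ nhds t := (hc.isOpen_preimage _ isOpen_compl_singleton).mem_nhds h
    obtain ⟨l, u, hlu, hs⟩ := mem_nhds_iff_exists_Ioo_subset.1 hn
    obtain ⟨p, hp1, hp2⟩ := exists_rat_btwn hlu.1
    obtain ⟨q, hq1, hq2⟩ := exists_rat_btwn hlu.2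
    exact ⟨(p, q), ⟨hp2, hq1⟩, fun s hs' => hs ⟨hp1.trans_le hs'.1, hs'.2.trans_lt hq2⟩⟩

lemma eq_of_mem_monotoneStrip (hd : ∀ b t, HasDerivAt (f b) (f' b t) t) {I : ℚ × ℚ}
    {b : Fin n → ℝ} {s t : ℝ} (hs : (s, b) ∈ monotoneStrip f' I)
    (ht : (t, b) ∈ monotoneStrip f' I) (h : f b s = f b t) : s = t := by
  wlog hst : s < t generalizing s t
  · rcases lt_trichotomy s t with h' | h' | h'
    · exact this hs ht h h'
    · exact h'
    · exact (this ht hs h.symm h').symm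
  obtain ⟨c, hc, hc'⟩ := exists_hasDerivAt_eq_zero hst
    (fun x _ => (hd b x).continuousAt.continuousWithinAt) h fun x _ => hd b x
  exact absurd hc' (hs.2 c ⟨hs.1.1.le.trans hc.1.le, hc.2.le.trans ht.1.2.le⟩)

/-- Images of the graph map of a family of functions are measurable on injectivity domains. -/
lemma measurableSet_image_graph (hf : Continuous (Function.uncurry f))
    (hd : ∀ b t, HasDerivAt (f b) (f' b t) t) {I : ℚ × ℚ} {D : Set (ℝ × (Fin n → ℝ))}
    (hD : MeasurableSet D) (hDI : D ⊆ monotoneStrip f' I) :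
    MeasurableSet ((fun z : ℝ × (Fin n → ℝ) => (f z.2 z.1, z.2)) '' D) := by
  refine hD.image_of_continuousOn_injOn ?_ ?_
  · have : Continuous fun z : ℝ × (Fin n → ℝ) => Function.uncurry f (z.2, z.1) :=
      hf.comp (by fun_prop)
    exact (this.prodMk continuous_snd).continuousOn
  · rintro ⟨s, b⟩ hs ⟨t, b'⟩ ht h
    simp only [Prod.mk.injEq] at h
    obtain ⟨h, rfl⟩ := h
    rw [eq_of_mem_monotoneStrip hd (hDI hs) (hDI ht) h]

lemma measure_critical_values (hf : Continuous (Function.uncurry f))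
    (hf' : Continuous (Function.uncurry f')) (hd : ∀ b t, HasDerivAt (f b) (f' b t) t)
    (ν : Measure ℝ) [SFinite ν] (hν : ν ≪ volume) (P : Measure (Fin n → ℝ)) [SFinite P] :
    (ν.prod P) ((fun z : ℝ × (Fin n → ℝ) => (f z.2 z.1, z.2)) '' {z | f' z.2 z.1 = 0}) = 0 := by
  have hm : MeasurableSet
      ((fun z : ℝ × (Fin n → ℝ) => (f z.2 z.1, z.2)) '' {z | f' z.2 z.1 = 0}) := by
    have h1 : IsClosed {z : ℝ × (Fin n → ℝ) | f' z.2 z.1 = 0} :=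
      isClosed_eq (hf'.comp (by fun_prop : Continuous fun z : ℝ × (Fin n → ℝ) => (z.2, z.1)))
        continuous_const
    have h2 : Continuous fun z : ℝ × (Fin n → ℝ) => (f z.2 z.1, z.2) :=
      (hf.comp (by fun_prop : Continuous fun z : ℝ × (Fin n → ℝ) => (z.2, z.1))).prodMk
        continuous_snd
    obtain ⟨K, hK, hU⟩ := ((isSigmaCompact_univ.of_isClosed_subset h1 (subset_univ _)).image h2)
    rw [← hU]
    exact MeasurableSet.iUnion fun k => (hK k).isClosed.measurableSet
  rw [Measure.prod_apply_symm hm]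
  refine lintegral_eq_zero_of_ae_eq_zero (Filter.Eventually.of_forall fun b => hν ?_)
  have : (fun y => (y, b)) ⁻¹' ((fun z : ℝ × (Fin n → ℝ) => (f z.2 z.1, z.2)) ''
      {z | f' z.2 z.1 = 0}) = f b '' {t | f' b t = 0} := by
    ext y
    simp only [mem_preimage, mem_image, Prod.exists, Prod.mk.injEq, mem_ofPred_eq]
    constructor
    · rintro ⟨t, b', h, h1, rfl⟩
      exact ⟨t, h, h1⟩
    · rintro ⟨t, h, h1⟩
      exact ⟨t, b, h, h1, rfl⟩
  rw [this]
  refine addHaar_image_eq_zero_of_det_fderivWithin_eq_zero volume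
    (f' := fun t => ContinuousLinearMap.toSpanSingleton ℝ (f' b t))
    (fun t _ => (hd b t).hasFDerivAt.hasFDerivWithinAt) ?_
  intro t ht
  simp only [mem_ofPred_eq] at ht
  simp [ht, ContinuousLinearMap.det]

open Classical in
/-- Area formula for a family of functions: averaged number of preimages of a random level. -/
theorem lintegral_encard_level_eq (hf : Continuous (Function.uncurry f))
    (hf' : Continuous (Function.uncurry f')) (hd : ∀ b t, HasDerivAt (f b) (f' b t) t)
    {ψ : ℝ → ℝ≥0∞} [SFinite (volume.withDensity ψ)]
    (P : Measure (Fin n → ℝ)) [SFinite P] :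
    ∫⁻ z : ℝ × (Fin n → ℝ), ({t : ℝ | f z.2 t = z.1}.encard : ℝ≥0∞)
        ∂((volume.withDensity ψ).prod P)
      = ∫⁻ b, (∫⁻ t, ENNReal.ofReal |f' b t| * ψ (f b t)) ∂P := by
  obtain ⟨e⟩ : Nonempty (ℕ ≃ ℚ × ℚ) := nonempty_equiv_of_countable
  set V : ℕ → Set (ℝ × (Fin n → ℝ)) := fun k => monotoneStrip f' (e k) with hV
  have hVm : ∀ k, MeasurableSet (V k) := fun k => measurableSet_monotoneStrip hf' _
  set D := disjointed V with hD
  have hDm : ∀ k, MeasurableSet (D k) := fun k => .disjointed hVm k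
  have hDV : ∀ k, D k ⊆ V k := fun k => disjointed_subset V k
  have hdisj : Pairwise (Function.onFun Disjoint D) := disjoint_disjointed V
  have hDU : ⋃ k, D k = {z | f' z.2 z.1 ≠ 0} := by
    rw [hD, iUnion_disjointed, ← iUnion_monotoneStrip hf']
    exact e.surjective.iUnion_comp (monotoneStrip f')
  set Φ : ℝ × (Fin n → ℝ) → ℝ × (Fin n → ℝ) := fun z => (f z.2 z.1, z.2) with hΦ
  have hΦm : ∀ k, MeasurableSet (Φ '' D k) := fun k =>
    measurableSet_image_graph hf hd (hDm k) (hDV k)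
  set S : ℕ → (Fin n → ℝ) → Set ℝ := fun k b => {t | (t, b) ∈ D k} with hS
  have hSm : ∀ k b, MeasurableSet (S k b) := fun k b => measurable_prodMk_right (hDm k)
  have hSd : ∀ b, Pairwise (Function.onFun Disjoint fun k => S k b) := fun b i j hij =>
    Set.disjoint_left.2 fun t hi hj => Set.disjoint_left.1 (hdisj hij) hi hj
  have hSU : ∀ b, ⋃ k, S k b = {t | f' b t ≠ 0} := by
    intro b
    ext t
    have := Set.ext_iff.1 hDU (t, b)
    simpa [hS] using this
  have hcount : ∀ z ∉ Φ '' {z | f' z.2 z.1 = 0},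
      ({t : ℝ | f z.2 t = z.1}.encard : ℝ≥0∞) = ∑' k, (Φ '' D k).indicator 1 z := by
    rintro ⟨y, b⟩ hz
    have hfc : Continuous (f b) := hf.comp (by fun_prop : Continuous fun s => (b, s))
    have hZ : MeasurableSet {t : ℝ | f b t = y} := (isClosed_eq hfc continuous_const).measurableSet
    have hZU : {t : ℝ | f b t = y} = ⋃ k, {t | f b t = y} ∩ S k b := by
      rw [← inter_iUnion, hSU, eq_comm, inter_eq_left]
      intro t ht h0
      exact hz ⟨(t, b), h0, by simpa [hΦ] using ht⟩
    rw [← Measure.count_apply hZ, hZU, measure_iUnion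
      (fun i j hij => ((hSd b) hij).mono inter_subset_right inter_subset_right)
      fun k => hZ.inter (hSm k b)]
    refine tsum_congr fun k => ?_
    rw [Measure.count_apply (hZ.inter (hSm k b))]
    by_cases hk : (y, b) ∈ Φ '' D k
    · rw [indicator_of_mem hk]
      obtain ⟨⟨t, b'⟩, ht, h⟩ := hk
      simp only [hΦ, Prod.mk.injEq] at h
      obtain ⟨h, rfl⟩ := h
      have : {s | f b' s = y} ∩ S k b' = {t} := by
        ext s
        simp only [mem_inter_iff, mem_ofPred_eq, mem_singleton_iff]
        constructor
        · rintro ⟨h1, h2⟩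
          exact eq_of_mem_monotoneStrip hd (hDV k h2) (hDV k ht) (h1.trans h.symm)
        · rintro rfl
          exact ⟨h, ht⟩
      simp [this]
    · rw [indicator_of_notMem hk]
      have : {s | f b s = y} ∩ S k b = ∅ := by
        ext s
        simp only [mem_inter_iff, mem_ofPred_eq, mem_empty_iff_false, iff_false, not_and]
        intro h1 h2
        exact hk ⟨(s, b), h2, by simp [hΦ, h1]⟩
      simp [this]
  have hae : ∀ᵐ z ∂((volume.withDensity ψ).prod P),
      ({t : ℝ | f z.2 t = z.1}.encard : ℝ≥0∞) = ∑' k, (Φ '' D k).indicator 1 z := by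
    have := measure_critical_values hf hf' hd (volume.withDensity ψ)
      (withDensity_absolutelyContinuous _ _) P
    filter_upwards [compl_mem_ae_iff.2 this] with z hz using hcount z hz
  have hsec : ∀ k b, (fun y => (y, b)) ⁻¹' (Φ '' D k) = f b '' S k b := by
    intro k b
    ext y
    simp only [mem_preimage, mem_image, Prod.exists, Prod.mk.injEq, hΦ, hS, mem_ofPred_eq]
    constructor
    · rintro ⟨t, b', h, h1, rfl⟩
      exact ⟨t, h, h1⟩
    · rintro ⟨t, h, h1⟩
      exact ⟨t, b, h, h1, rfl⟩
  have hone : ∀ k b, (volume.withDensity ψ) ((fun y => (y, b)) ⁻¹' (Φ '' D k))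
      = ∫⁻ t in S k b, ENNReal.ofReal |f' b t| * ψ (f b t) := by
    intro k b
    rw [withDensity_apply _ (measurable_prodMk_right (hΦm k)), hsec]
    exact lintegral_image_eq_lintegral_abs_deriv_mul (hSm k b)
      (fun t _ => (hd b t).hasDerivWithinAt)
      (fun s hs t ht h => eq_of_mem_monotoneStrip hd (hDV k hs) (hDV k ht) h) ψ
  rw [lintegral_congr_ae hae, lintegral_tsum fun k =>
    ((measurable_one.indicator (hΦm k)).aemeasurable)]
  simp_rw [lintegral_indicator_one (hΦm _), Measure.prod_apply_symm (hΦm _)]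
  rw [← lintegral_tsum fun k => (measurable_measure_prodMk_right (hΦm k)).aemeasurable]
  refine lintegral_congr fun b => ?_
  simp_rw [hone]
  rw [← lintegral_iUnion (fun k => hSm k b) (hSd b), hSU]
  rw [← lintegral_indicator]
  · refine lintegral_congr fun t => ?_
    by_cases h : f' b t = 0
    · simp [h]
    · rw [indicator_of_mem (by exact h)]
  · have : Continuous (f' b) := hf'.comp (by fun_prop : Continuous fun s => (b, s))
    exact (this.isOpen_preimage _ isOpen_compl_singleton).measurableSet

end AreaFormula

/-- Zeros of a polynomial with independent normal coefficients are unaffected by rescaling. -/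
lemma lintegral_encard_zeros_rescale (μ σ : ℝ) (hσ : 0 < σ) (n : ℕ) :
    ∫⁻ a : Fin (n + 1) → ℝ, ({t : ℝ | ∑ i, a i * t ^ (i : ℕ) = 0}.encard : ℝ≥0∞)
        ∂(Measure.pi fun _ => gaussianReal μ (Real.toNNReal (σ ^ 2)))
      = ∫⁻ a : Fin (n + 1) → ℝ, ({t : ℝ | ∑ i, a i * t ^ (i : ℕ) = 0}.encard : ℝ≥0∞)
        ∂(Measure.pi fun _ => gaussianReal (μ / σ) 1) := by
  set e : (Fin (n + 1) → ℝ) ≃ᵐ (Fin (n + 1) → ℝ) :=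
    MeasurableEquiv.piCongrRight fun _ => (Homeomorph.mulLeft₀ σ hσ.ne').toMeasurableEquiv with he
  have h1 : (Measure.pi fun _ : Fin (n + 1) => gaussianReal μ (Real.toNNReal (σ ^ 2)))
      = (Measure.pi fun _ : Fin (n + 1) => gaussianReal (μ / σ) 1).map e := by
    have h2 : (gaussianReal (μ / σ) 1).map (fun x => σ * x)
        = gaussianReal μ (Real.toNNReal (σ ^ 2)) := by
      rw [gaussianReal_map_const_mul]
      congr 1
      · field_simp
      · ext
        simp [max_eq_left (sq_nonneg σ)]
    have h3 := Measure.pi_map_pi (μ := fun _ : Fin (n + 1) => gaussianReal (μ / σ) 1)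
      (f := fun _ x => σ * x) fun _ => by fun_prop
    simp only [h2] at h3
    rw [← h3]
    rfl
  rw [h1, lintegral_map_equiv]
  refine lintegral_congr fun a => ?_
  congr 3
  ext t
  have : ∑ i, e a i * t ^ (i : ℕ) = σ * ∑ i, a i * t ^ (i : ℕ) := by
    rw [Finset.mul_sum]
    refine Finset.sum_congr rfl fun i _ => ?_
    change σ * a i * t ^ (i : ℕ) = _
    ring
  have hσ0 := hσ.ne'
  simp [this, hσ0]

/-- Kac–Rice formula for a polynomial with independent standardized normal coefficients. -/
theorem lintegral_encard_zeros_eq (m : ℝ) (n : ℕ) :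
    ∫⁻ a : Fin (n + 1) → ℝ, ({t : ℝ | ∑ i, a i * t ^ (i : ℕ) = 0}.encard : ℝ≥0∞)
        ∂(Measure.pi fun _ => gaussianReal m 1)
      = ∫⁻ t : ℝ, ∫⁻ b : Fin n → ℝ,
          ENNReal.ofReal |∑ i, b i * ((i + 1 : ℕ) * t ^ (i : ℕ))|
            * gaussianPDF m 1 (-∑ i, b i * t ^ (i + 1 : ℕ))
          ∂(Measure.pi fun _ => gaussianReal m 1) := by
  set f : (Fin n → ℝ) → ℝ → ℝ := fun b t => -∑ i, b i * t ^ (i + 1 : ℕ) with hf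
  set f' : (Fin n → ℝ) → ℝ → ℝ := fun b t => -∑ i, b i * ((i + 1 : ℕ) * t ^ (i : ℕ)) with hf'
  have hfc : Continuous (Function.uncurry f) := by
    simp only [Function.uncurry_def, hf]
    fun_prop
  have hfc' : Continuous (Function.uncurry f') := by
    simp only [Function.uncurry_def, hf']
    fun_prop
  have hd : ∀ b t, HasDerivAt (f b) (f' b t) t := by
    intro b t
    refine (HasDerivAt.fun_sum fun i _ => ?_).neg
    simpa using (hasDerivAt_pow (i + 1 : ℕ) t).const_mul (b i)
  have hmp := measurePreserving_piFinSuccAbove (fun _ : Fin (n + 1) => gaussianReal m 1) 0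
  have hγ : gaussianReal m 1 = volume.withDensity (gaussianPDF m 1) :=
    gaussianReal_of_var_ne_zero m one_ne_zero
  have hsf : SFinite (volume.withDensity (gaussianPDF m 1)) := hγ ▸ inferInstance
  have h1 : ∀ a : Fin (n + 1) → ℝ, ({t : ℝ | ∑ i, a i * t ^ (i : ℕ) = 0}.encard : ℝ≥0∞)
      = (fun z : ℝ × (Fin n → ℝ) => ({t : ℝ | f z.2 t = z.1}.encard : ℝ≥0∞))
        (MeasurableEquiv.piFinSuccAbove (fun _ => ℝ) 0 a) := by
    intro a
    congr 3
    ext t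
    have e1 : (MeasurableEquiv.piFinSuccAbove (fun _ => ℝ) 0 a).1 = a 0 := rfl
    have e2 : ∀ i, (MeasurableEquiv.piFinSuccAbove (fun _ => ℝ) 0 a).2 i = a i.succ := fun i => rfl
    simp only [e1, e2, hf, Fin.sum_univ_succ, Fin.val_zero, pow_zero, mul_one, Fin.val_succ]
    constructor <;> intro h <;> linarith
  rw [lintegral_congr h1, hmp.lintegral_comp_emb (MeasurableEquiv.measurableEmbedding _)
    (fun z : ℝ × (Fin n → ℝ) => ({t : ℝ | f z.2 t = z.1}.encard : ℝ≥0∞))]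
  have h2 := lintegral_encard_level_eq hfc hfc' hd (ψ := gaussianPDF m 1)
    (Measure.pi fun _ => gaussianReal m 1)
  rw [← hγ] at h2
  rw [h2, lintegral_lintegral_swap]
  · simp [hf, hf', abs_neg]
  · have := (measurable_gaussianPDF m 1).comp hfc.measurable
    exact ((by fun_prop : Measurable fun z => ENNReal.ofReal |Function.uncurry f' z|).mul
      this).aemeasurable

section AbsMoment

open Filter Topology

lemma gaussianPDFReal_zero_one (x : ℝ) :
    gaussianPDFReal 0 1 x = (√(2 * π))⁻¹ * rexp (-x ^ 2 / 2) := by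
  simp [gaussianPDFReal]

lemma continuous_gaussianPDFReal_zero_one : Continuous (gaussianPDFReal 0 1) := by
  rw [funext gaussianPDFReal_zero_one]
  fun_prop

lemma gaussianPDFReal_zero_one_neg (x : ℝ) :
    gaussianPDFReal 0 1 (-x) = gaussianPDFReal 0 1 x := by
  simp [gaussianPDFReal_zero_one]

lemma hasDerivAt_gaussianPDFReal_zero_one (x : ℝ) :
    HasDerivAt (gaussianPDFReal 0 1) (-x * gaussianPDFReal 0 1 x) x := by
  rw [funext gaussianPDFReal_zero_one]
  have h : HasDerivAt (fun x : ℝ => -x ^ 2 / 2) (-x) x := by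
    refine (((hasDerivAt_pow 2 x).neg).div_const 2).congr_deriv ?_
    push_cast
    ring
  refine (h.exp.const_mul (√(2 * π))⁻¹).congr_deriv ?_
  ring

lemma gaussianPDFReal_zero_one_zero_le : gaussianPDFReal 0 1 0 ≤ 1 / 2 := by
  rw [gaussianPDFReal_zero_one]
  have h : (2 : ℝ) ≤ √(2 * π) := by
    rw [Real.le_sqrt (by norm_num) (by positivity)]
    nlinarith [pi_gt_three]
  simp only [ne_eq, OfNat.ofNat_ne_zero, not_false_eq_true, zero_pow, neg_zero, zero_div, exp_zero,
    mul_one]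
  rw [one_div]
  exact inv_anti₀ (by norm_num) h

lemma gaussianPDFReal_zero_one_le (x : ℝ) : gaussianPDFReal 0 1 x ≤ gaussianPDFReal 0 1 0 := by
  rw [gaussianPDFReal_zero_one, gaussianPDFReal_zero_one]
  refine mul_le_mul_of_nonneg_left (exp_le_exp.2 ?_) (by positivity)
  nlinarith [sq_nonneg x]

lemma two_mul_gaussianPDFReal_zero_one_zero_sq : 2 * gaussianPDFReal 0 1 0 ^ 2 = 1 / π := by
  rw [gaussianPDFReal_zero_one]
  simp only [ne_eq, OfNat.ofNat_ne_zero, not_false_eq_true, zero_pow, neg_zero, zero_div, exp_zero,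
    mul_one, inv_pow]
  rw [Real.sq_sqrt (by positivity)]
  field_simp

lemma two_mul_gaussianPDFReal_zero_one_sq (x : ℝ) :
    2 * gaussianPDFReal 0 1 x ^ 2 = 1 / π * rexp (-x ^ 2) := by
  have h := two_mul_gaussianPDFReal_zero_one_zero_sq
  rw [gaussianPDFReal_zero_one] at h ⊢
  simp only [ne_eq, OfNat.ofNat_ne_zero, not_false_eq_true, zero_pow, neg_zero, zero_div, exp_zero,
    mul_one] at h
  rw [mul_pow, ← mul_assoc, h, ← Real.exp_nat_mul]
  congr 2
  push_cast
  ring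

/-- The probability that a standard normal variable lies in `[-x, x]` (an odd function of `x`). -/
noncomputable def normalMass (x : ℝ) : ℝ := 2 * ∫ s in (0 : ℝ)..x, gaussianPDFReal 0 1 s

/-- The mean of `|N + x|` for a standard normal variable `N`. -/
noncomputable def absMean (x : ℝ) : ℝ := 2 * gaussianPDFReal 0 1 x + x * normalMass x

lemma hasDerivAt_normalMass (x : ℝ) :
    HasDerivAt normalMass (2 * gaussianPDFReal 0 1 x) x :=
  (intervalIntegral.integral_hasDerivAt_right
    (continuous_gaussianPDFReal_zero_one.intervalIntegrable _ _)
    (continuous_gaussianPDFReal_zero_one.stronglyMeasurableAtFilter _ _)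
    continuous_gaussianPDFReal_zero_one.continuousAt).const_mul 2

lemma normalMass_zero : normalMass 0 = 0 := by simp [normalMass]

lemma normalMass_neg (x : ℝ) : normalMass (-x) = -normalMass x := by
  have h := intervalIntegral.integral_comp_neg (a := 0) (b := x) (gaussianPDFReal 0 1)
  simp only [gaussianPDFReal_zero_one_neg, neg_zero] at h
  rw [normalMass, normalMass, h, intervalIntegral.integral_symm]
  ring

lemma tendsto_normalMass_atTop : Tendsto normalMass atTop (𝓝 1) := by
  have h := intervalIntegral_tendsto_integral_Ioi (μ := volume) 0
    (integrable_gaussianPDFReal 0 1).integrableOn tendsto_id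
  have h2 : ∫ x in Ioi (0 : ℝ), gaussianPDFReal 0 1 x = 1 / 2 := by
    simp_rw [gaussianPDFReal_zero_one]
    rw [integral_const_mul]
    have := integral_gaussian_Ioi (1 / 2)
    have e : ∀ x : ℝ, -x ^ 2 / 2 = -(1 / 2) * x ^ 2 := fun x => by ring
    simp_rw [e]
    rw [this, show π / (1 / 2) = 2 * π by ring]
    have : √(2 * π) ≠ 0 := (Real.sqrt_pos.2 (by positivity)).ne'
    field_simp
  rw [h2] at h
  have := h.const_mul 2
  norm_num at this
  exact this

lemma tendsto_normalMass_atBot : Tendsto normalMass atBot (𝓝 (-1)) := by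
  have h := (tendsto_normalMass_atTop.comp tendsto_neg_atBot_atTop).neg
  refine h.congr fun x => ?_
  simp [normalMass_neg]

lemma tendsto_gaussianPDFReal_zero_one_atTop : Tendsto (gaussianPDFReal 0 1) atTop (𝓝 0) := by
  rw [funext gaussianPDFReal_zero_one]
  have h : Tendsto (fun x : ℝ => -x ^ 2 / 2) atTop atBot := by
    have : Tendsto (fun x : ℝ => x ^ 2 / 2) atTop atTop :=
      (tendsto_pow_atTop two_ne_zero).atTop_div_const (by norm_num)
    exact (tendsto_neg_atTop_atBot.comp this).congr fun x => (neg_div _ _).symm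
  simpa using (tendsto_exp_atBot.comp h).const_mul (√(2 * π))⁻¹

lemma tendsto_gaussianPDFReal_zero_one_atBot : Tendsto (gaussianPDFReal 0 1) atBot (𝓝 0) :=
  (tendsto_gaussianPDFReal_zero_one_atTop.comp tendsto_neg_atBot_atTop).congr fun x =>
    gaussianPDFReal_zero_one_neg x

lemma integrable_abs_add_mul_gaussianPDFReal (x : ℝ) :
    Integrable fun y => |y + x| * gaussianPDFReal 0 1 y := by
  have h : Integrable (fun y : ℝ => |y + x|) (gaussianReal 0 1) :=
    (((memLp_id_gaussianReal 1).integrable le_rfl).add (integrable_const x)).abs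
  rw [gaussianReal_of_var_ne_zero 0 one_ne_zero,
    integrable_withDensity_iff (measurable_gaussianPDF 0 1)
    (Eventually.of_forall fun _ => gaussianPDF_lt_top)] at h
  simpa [toReal_gaussianPDF] using h

lemma integral_abs_add_mul_gaussianPDFReal (x : ℝ) :
    ∫ y, |y + x| * gaussianPDFReal 0 1 y = absMean x := by
  have hi := integrable_abs_add_mul_gaussianPDFReal x
  rw [← intervalIntegral.integral_Iic_add_Ioi (b := -x) hi.integrableOn hi.integrableOn]
  have hR : ∀ y, HasDerivAt (fun y => -gaussianPDFReal 0 1 y + x / 2 * normalMass y)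
      ((y + x) * gaussianPDFReal 0 1 y) y := fun y =>
    ((hasDerivAt_gaussianPDFReal_zero_one y).neg.add
      ((hasDerivAt_normalMass y).const_mul (x / 2))).congr_deriv (by ring)
  have h1 : ∫ y in Ioi (-x), |y + x| * gaussianPDFReal 0 1 y
      = x / 2 + gaussianPDFReal 0 1 x + x / 2 * normalMass x := by
    have e : EqOn (fun y => |y + x| * gaussianPDFReal 0 1 y)
        (fun y => (y + x) * gaussianPDFReal 0 1 y) (Ioi (-x)) := by
      intro y hy
      simp only [mem_Ioi] at hy
      simp only
      rw [abs_of_pos (by linarith)]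
    rw [setIntegral_congr_fun measurableSet_Ioi e,
      integral_Ioi_of_hasDerivAt_of_tendsto' (fun y _ => hR y)
      (hi.integrableOn.congr_fun e measurableSet_Ioi)
      (tendsto_gaussianPDFReal_zero_one_atTop.neg.add
        (tendsto_normalMass_atTop.const_mul (x / 2)))]
    rw [gaussianPDFReal_zero_one_neg, normalMass_neg]
    ring
  have h2 : ∫ y in Iic (-x), |y + x| * gaussianPDFReal 0 1 y
      = gaussianPDFReal 0 1 x + x / 2 * normalMass x - x / 2 := by
    have e : EqOn (fun y => |y + x| * gaussianPDFReal 0 1 y)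
        (fun y => -((y + x) * gaussianPDFReal 0 1 y)) (Iic (-x)) := by
      intro y hy
      simp only [mem_Iic] at hy
      simp only
      rw [abs_of_nonpos (by linarith)]
      ring
    rw [setIntegral_congr_fun measurableSet_Iic e,
      integral_Iic_of_hasDerivAt_of_tendsto' (fun y _ => (hR y).neg)
      (hi.integrableOn.congr_fun e measurableSet_Iic)
      (tendsto_gaussianPDFReal_zero_one_atBot.neg.add
        (tendsto_normalMass_atBot.const_mul (x / 2))).neg]
    simp only [Pi.neg_apply]
    rw [gaussianPDFReal_zero_one_neg, normalMass_neg]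
    ring
  rw [h1, h2, absMean]
  ring

lemma lintegral_abs_gaussianReal (b : ℝ) {v : ℝ≥0} (hv : v ≠ 0) :
    ∫⁻ z, ENNReal.ofReal |z| ∂(gaussianReal b v)
      = ENNReal.ofReal (√v * absMean (b / √v)) := by
  have hs : 0 < √(v : ℝ) := Real.sqrt_pos.2 (by positivity)
  have h1 : gaussianReal b v = (gaussianReal 0 1).map (fun y => √v * y + b) := by
    have e : (fun y => √(v : ℝ) * y + b) = (fun y => y + b) ∘ (fun y => √(v : ℝ) * y) := rfl
    rw [e, ← Measure.map_map (by fun_prop) (by fun_prop), gaussianReal_map_const_mul,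
      gaussianReal_map_add_const]
    congr 1
    · ring
    · ext
      simp [Real.sq_sqrt]
  have hm := integrable_abs_add_mul_gaussianPDFReal (b / √v)
  rw [h1, lintegral_map (by fun_prop) (by fun_prop), gaussianReal_of_var_ne_zero 0 one_ne_zero,
    lintegral_withDensity_eq_lintegral_mul _ (measurable_gaussianPDF 0 1) (by fun_prop),
    ← integral_abs_add_mul_gaussianPDFReal, ← integral_const_mul,
    ofReal_integral_eq_lintegral_ofReal (hm.const_mul _)]
  · refine lintegral_congr fun y => ?_
    rw [Pi.mul_apply, gaussianPDF, ← ENNReal.ofReal_mul (gaussianPDFReal_nonneg _ _ _)]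
    congr 1
    have : √(v : ℝ) * y + b = √v * (y + b / √v) := by field_simp
    rw [this, abs_mul, abs_of_pos hs]
    ring
  · refine Eventually.of_forall fun y => ?_
    have := gaussianPDFReal_nonneg 0 1 y
    simp only [Pi.zero_apply]
    positivity

lemma normalMass_nonneg {x : ℝ} (hx : 0 ≤ x) : 0 ≤ normalMass x :=
  mul_nonneg zero_le_two
    (intervalIntegral.integral_nonneg (μ := volume) hx fun _ _ => gaussianPDFReal_nonneg _ _ _)

lemma normalMass_le {x : ℝ} (hx : 0 ≤ x) : normalMass x ≤ 2 * gaussianPDFReal 0 1 0 * x := by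
  have h := intervalIntegral.integral_mono_on (μ := volume) (a := 0) (b := x) hx
    (continuous_gaussianPDFReal_zero_one.intervalIntegrable _ _)
    (continuous_const.intervalIntegrable _ _) (g := fun _ => gaussianPDFReal 0 1 0)
    fun y _ => gaussianPDFReal_zero_one_le y
  simp only [intervalIntegral.integral_const, sub_zero, smul_eq_mul] at h
  rw [normalMass]
  linarith

lemma absMean_neg (x : ℝ) : absMean (-x) = absMean x := by
  simp [absMean, normalMass_neg, gaussianPDFReal_zero_one_neg]

lemma absMean_abs (x : ℝ) : absMean |x| = absMean x := by
  rcases abs_choice x with h | h <;> rw [h]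
  exact absMean_neg x

lemma hasDerivAt_absMean (x : ℝ) : HasDerivAt absMean (normalMass x) x :=
  (((hasDerivAt_gaussianPDFReal_zero_one x).const_mul 2).add
    ((hasDerivAt_id x).mul (hasDerivAt_normalMass x))).congr_deriv (by simp; ring)

lemma continuous_absMean : Continuous absMean :=
  continuous_iff_continuousAt.2 fun x => (hasDerivAt_absMean x).continuousAt

lemma absMean_zero : absMean 0 = 2 * gaussianPDFReal 0 1 0 := by simp [absMean]

lemma monotoneOn_absMean : MonotoneOn absMean (Ici 0) := by
  refine monotoneOn_of_hasDerivWithinAt_nonneg (f' := normalMass) (convex_Ici 0)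
    continuous_absMean.continuousOn (fun x _ => (hasDerivAt_absMean x).hasDerivWithinAt) ?_
  intro x hx
  rw [interior_Ici] at hx
  exact normalMass_nonneg (le_of_lt hx)

lemma monotoneOn_sq_sub_absMean :
    MonotoneOn (fun x => gaussianPDFReal 0 1 0 * x ^ 2 - absMean x) (Ici 0) := by
  have hd : ∀ x, HasDerivAt (fun x => gaussianPDFReal 0 1 0 * x ^ 2 - absMean x)
      (2 * gaussianPDFReal 0 1 0 * x - normalMass x) x := fun x =>
    (((hasDerivAt_pow 2 x).const_mul _).sub (hasDerivAt_absMean x)).congr_deriv (by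
      push_cast; ring)
  refine monotoneOn_of_hasDerivWithinAt_nonneg (convex_Ici 0)
    (fun x _ => (hd x).continuousAt.continuousWithinAt)
    (fun x _ => (hd x).hasDerivWithinAt) ?_
  intro x hx
  rw [interior_Ici] at hx
  exact sub_nonneg.2 (normalMass_le (le_of_lt hx))

lemma abs_absMean_sqrt_sub_le {v w : ℝ} (hv : 0 ≤ v) (hw : 0 ≤ w) :
    |absMean √v - absMean √w| ≤ gaussianPDFReal 0 1 0 * |v - w| := by
  wlog h : w ≤ v generalizing v w
  · rw [abs_sub_comm, abs_sub_comm v]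
    exact this hw hv (le_of_not_ge h)
  have h0 : √w ≤ √v := Real.sqrt_le_sqrt h
  have h1 := monotoneOn_absMean (Real.sqrt_nonneg w) (Real.sqrt_nonneg v) h0
  have h2 := monotoneOn_sq_sub_absMean (Real.sqrt_nonneg w) (Real.sqrt_nonneg v) h0
  simp only [Real.sq_sqrt hv, Real.sq_sqrt hw] at h2
  rw [abs_of_nonneg (sub_nonneg.2 h1), abs_of_nonneg (sub_nonneg.2 h)]
  linarith

lemma absMean_nonneg (x : ℝ) : 0 ≤ absMean x := by
  rw [← absMean_abs]
  exact add_nonneg (mul_nonneg zero_le_two (gaussianPDFReal_nonneg _ _ _))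
    (mul_nonneg (abs_nonneg x) (normalMass_nonneg (abs_nonneg x)))

end AbsMoment

section KacRiceDensity

variable {n : ℕ}

lemma hasGaussianLaw_pi_gaussianReal (m : ℝ) :
    HasGaussianLaw (fun a : Fin n → ℝ => fun i => a i)
      (Measure.pi fun _ : Fin n => gaussianReal m 1) := by
  refine iIndepFun.hasGaussianLaw (X := fun (i : Fin n) (a : Fin n → ℝ) => a i) (fun i => ?_) ?_
  · have h := (measurePreserving_eval (fun _ : Fin n => gaussianReal m 1) i).map_eq
    refine ⟨?_⟩
    have h' : (Measure.pi fun _ : Fin n => gaussianReal m 1).map (fun a => a i)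
        = gaussianReal m 1 := h
    rw [h']
    infer_instance
  · exact iIndepFun_pi (X := fun _ x => x) fun _ => aemeasurable_id

lemma covariance_pi_gaussianReal (m : ℝ) (i j : Fin n) :
    cov[fun a => a i, fun a => a j; Measure.pi fun _ : Fin n => gaussianReal m 1]
      = if i = j then 1 else 0 := by
  have hL : ∀ i : Fin n, MemLp (fun a : Fin n → ℝ => a i) 2
      (Measure.pi fun _ : Fin n => gaussianReal m 1) := fun i =>
    ((hasGaussianLaw_pi_gaussianReal m).eval i).memLp_two
  split_ifs with h
  · subst h
    rw [covariance_self (measurable_pi_apply i).aemeasurable]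
    have h := (measurePreserving_eval (fun _ : Fin n => gaussianReal m 1) i)
    have h2 := h.variance_fun_comp (f := id) aemeasurable_id
    simpa using h2
  · have hi : iIndepFun (fun i (a : Fin n → ℝ) => a i)
        (Measure.pi fun _ : Fin n => gaussianReal m 1) :=
      iIndepFun_pi (X := fun _ x => x) fun _ => aemeasurable_id
    exact (hi.indepFun h).covariance_eq_zero (hL i) (hL j)

lemma covariance_linear_pi_gaussianReal (m : ℝ) (b r : Fin n → ℝ) :
    cov[fun a => ∑ i, a i * b i, fun a => ∑ i, a i * r i;
      Measure.pi fun _ : Fin n => gaussianReal m 1] = ∑ i, b i * r i := by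
  have hL : ∀ i : Fin n, MemLp (fun a : Fin n → ℝ => a i) 2
      (Measure.pi fun _ : Fin n => gaussianReal m 1) := fun i =>
    ((hasGaussianLaw_pi_gaussianReal m).eval i).memLp_two
  rw [covariance_fun_sum_fun_sum (fun i => (hL i).mul_const _) (fun i => (hL i).mul_const _)]
  simp_rw [covariance_mul_const_left, covariance_mul_const_right, covariance_pi_gaussianReal]
  simp [mul_comm]

lemma integral_linear_pi_gaussianReal (m : ℝ) (b : Fin n → ℝ) :
    ∫ a, ∑ i, a i * b i ∂(Measure.pi fun _ : Fin n => gaussianReal m 1) = m * ∑ i, b i := by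
  rw [integral_finsetSum _ fun i _ =>
    (((hasGaussianLaw_pi_gaussianReal m).eval i).integrable).mul_const _]
  simp_rw [integral_mul_const]
  rw [Finset.mul_sum]
  refine Finset.sum_congr rfl fun i _ => ?_
  have h := (measurePreserving_eval (fun _ : Fin n => gaussianReal m 1) i)
  have h3 : ∫ a : Fin n → ℝ, a i ∂(Measure.pi fun _ : Fin n => gaussianReal m 1) = m := by
    have h4 := integral_id_gaussianReal (μ := m) (v := 1)
    rw [← h.map_eq, integral_map h.aemeasurable (by fun_prop)] at h4
    exact h4
  rw [h3]

/-- Orthogonal linear forms in iid normals have independent normal laws. -/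
lemma map_linear_pair_pi_gaussianReal (m : ℝ) (b r : Fin n → ℝ) (h : ∑ i, b i * r i = 0) :
    (Measure.pi fun _ : Fin n => gaussianReal m 1).map
        (fun a => (∑ i, a i * b i, ∑ i, a i * r i))
      = (gaussianReal (m * ∑ i, b i) (∑ i, b i ^ 2).toNNReal).prod
        (gaussianReal (m * ∑ i, r i) (∑ i, r i ^ 2).toNNReal) := by
  have hG : HasGaussianLaw (fun a : Fin n → ℝ => (∑ i, a i * b i, ∑ i, a i * r i))
      (Measure.pi fun _ : Fin n => gaussianReal m 1) := by
    have := (hasGaussianLaw_pi_gaussianReal (n := n) m).map_fun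
      ((∑ i, b i • ContinuousLinearMap.proj (R := ℝ) (φ := fun _ : Fin n => ℝ) i).prod
        (∑ i, r i • ContinuousLinearMap.proj (R := ℝ) (φ := fun _ : Fin n => ℝ) i))
    simpa [mul_comm] using this
  have hm : ∀ b : Fin n → ℝ, AEMeasurable (fun a : Fin n → ℝ => ∑ i, a i * b i)
      (Measure.pi fun _ : Fin n => gaussianReal m 1) := fun b =>
    (Measurable.aemeasurable (by fun_prop))
  have hlaw : ∀ b : Fin n → ℝ, HasGaussianLaw (fun a => ∑ i, a i * b i)
      (Measure.pi fun _ : Fin n => gaussianReal m 1) →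
      (Measure.pi fun _ : Fin n => gaussianReal m 1).map (fun a => ∑ i, a i * b i)
        = gaussianReal (m * ∑ i, b i) (∑ i, b i ^ 2).toNNReal := by
    intro b hb
    rw [hb.map_eq_gaussianReal, integral_linear_pi_gaussianReal, ← covariance_self (hm b),
      covariance_linear_pi_gaussianReal]
    simp [pow_two]
  rw [(indepFun_iff_map_prod_eq_prod_map_map (hm b) (hm r)).1
    (hG.indepFun_of_covariance_eq_zero (by rw [covariance_linear_pi_gaussianReal, h])),
    hlaw b hG.fst, hlaw r hG.snd]

lemma gaussianPDFReal_mul_neg (m u x : ℝ) {s : ℝ≥0} (hs : s ≠ 0) :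
    gaussianPDFReal u s x * gaussianPDFReal m 1 (-x)
      = gaussianPDFReal (u + m) (1 + s) 0
        * gaussianPDFReal ((u - m * s) / (1 + s)) (s / (1 + s)) x := by
  have hs0 : (0 : ℝ) < s := by positivity
  simp only [gaussianPDFReal, NNReal.coe_add, NNReal.coe_one, NNReal.coe_div]
  have e1 : ∀ a b c d : ℝ, (a * rexp b) * (c * rexp d) = (a * c) * rexp (b + d) :=
    fun a b c d => by rw [Real.exp_add]; ring
  rw [e1, e1, ← mul_inv, ← mul_inv, ← Real.sqrt_mul (by positivity),
    ← Real.sqrt_mul (by positivity)]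
  refine congrArg₂ (fun x y => (√x)⁻¹ * rexp y) ?_ ?_
  · field_simp
  · field_simp
    ring

lemma lintegral_abs_mul_gaussianPDF_neg (m u c w : ℝ) {s r v : ℝ≥0} (hs : s ≠ 0)
    (hv : (v : ℝ) = c ^ 2 * (s / (1 + s)) + r) (hv0 : v ≠ 0) :
    ∫⁻ x, (∫⁻ y, ENNReal.ofReal |c * x + y| ∂gaussianReal w r) * gaussianPDF m 1 (-x)
        ∂gaussianReal u s
      = ENNReal.ofReal (gaussianPDFReal (u + m) (1 + s) 0
        * (√v * absMean ((c * ((u - m * s) / (1 + s)) + w) / √v))) := by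
  have hs1 : s / (1 + s) ≠ 0 := by positivity
  have hm : Measurable fun x => ∫⁻ y, ENNReal.ofReal |c * x + y| ∂gaussianReal w r := by
    refine Measurable.lintegral_prod_right'
      (f := fun z : ℝ × ℝ => ENNReal.ofReal |c * z.1 + z.2|) ?_
    fun_prop
  rw [gaussianReal_of_var_ne_zero _ hs, lintegral_withDensity_eq_lintegral_mul _ (by fun_prop)
    (by fun_prop)]
  have h1 : ∀ x, (gaussianPDF u s * fun x =>
      (∫⁻ y, ENNReal.ofReal |c * x + y| ∂gaussianReal w r) * gaussianPDF m 1 (-x)) x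
      = ENNReal.ofReal (gaussianPDFReal (u + m) (1 + s) 0)
        * ((gaussianPDF ((u - m * s) / (1 + s)) (s / (1 + s)) * fun x =>
            (∫⁻ y, ENNReal.ofReal |c * x + y| ∂gaussianReal w r)) x) := by
    intro x
    have := congrArg ENNReal.ofReal (gaussianPDFReal_mul_neg m u x hs)
    rw [ENNReal.ofReal_mul (gaussianPDFReal_nonneg _ _ _),
      ENNReal.ofReal_mul (gaussianPDFReal_nonneg _ _ _)] at this
    simp only [Pi.mul_apply, gaussianPDF]
    rw [mul_comm (lintegral _ _), ← mul_assoc, this, mul_assoc]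
  simp_rw [h1]
  rw [lintegral_const_mul _ (by fun_prop), ← lintegral_withDensity_eq_lintegral_mul _ (by fun_prop)
    hm,
    ← gaussianReal_of_var_ne_zero _ hs1]
  have h2 : ∫⁻ x, ∫⁻ y, ENNReal.ofReal |c * x + y| ∂gaussianReal w r
      ∂gaussianReal ((u - m * s) / (1 + s)) (s / (1 + s))
      = ∫⁻ z, ENNReal.ofReal |z| ∂gaussianReal (c * ((u - m * s) / (1 + s)) + w) v := by
    have h3 := gaussianReal_conv_gaussianReal (m₁ := c * ((u - m * s) / (1 + s))) (m₂ := w)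
      (v₁ := .mk (c ^ 2) (sq_nonneg _) * (s / (1 + s))) (v₂ := r)
    have h4 : NNReal.mk (c ^ 2) (sq_nonneg _) * (s / (1 + s)) + r = v := by
      ext
      simp [hv]
    rw [h4] at h3
    rw [← h3, Measure.lintegral_conv (by fun_prop), ← gaussianReal_map_const_mul,
      lintegral_map ?_ (by fun_prop)]
    refine Measurable.lintegral_prod_right'
      (f := fun z : ℝ × ℝ => ENNReal.ofReal |z.1 + z.2|) ?_
    fun_prop
  rw [h2, lintegral_abs_gaussianReal _ hv0, ← ENNReal.ofReal_mul (gaussianPDFReal_nonneg _ _ _)]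

/-- The Kac–Rice density for a linear form `∑ aᵢ dᵢ` conditioned on `a + ∑ aᵢ bᵢ = 0`, for iid
normals. -/
lemma lintegral_abs_linear_mul_gaussianPDF (m : ℝ) (b d : Fin n → ℝ) (hb : 0 < ∑ i, b i ^ 2)
    (hv : 0 < ∑ i, d i ^ 2 - (∑ i, b i * d i) ^ 2 / (1 + ∑ i, b i ^ 2)) :
    ∫⁻ a : Fin n → ℝ, ENNReal.ofReal |∑ i, a i * d i| * gaussianPDF m 1 (-∑ i, a i * b i)
        ∂(Measure.pi fun _ => gaussianReal m 1)
      = ENNReal.ofReal (gaussianPDFReal (m * (1 + ∑ i, b i)) (1 + (∑ i, b i ^ 2).toNNReal) 0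
        * (√(∑ i, d i ^ 2 - (∑ i, b i * d i) ^ 2 / (1 + ∑ i, b i ^ 2))
          * absMean (m * (∑ i, d i - (∑ i, b i * d i) * (1 + ∑ i, b i) / (1 + ∑ i, b i ^ 2))
            / √(∑ i, d i ^ 2 - (∑ i, b i * d i) ^ 2 / (1 + ∑ i, b i ^ 2))))) := by
  set s := ∑ i, b i ^ 2 with hs
  set c := (∑ i, b i * d i) / s with hc
  set r : Fin n → ℝ := fun i => d i - c * b i with hr
  have hbr : ∑ i, b i * r i = 0 := by
    have : ∑ i, b i * r i = ∑ i, b i * d i - c * s := by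
      rw [hs, Finset.mul_sum, ← Finset.sum_sub_distrib]
      exact Finset.sum_congr rfl fun i _ => by simp only [hr]; ring
    rw [this, hc]
    field_simp
    ring
  have hsr : ∑ i, r i = ∑ i, d i - c * ∑ i, b i := by
    rw [Finset.mul_sum, ← Finset.sum_sub_distrib]
  have hrr : ∑ i, r i ^ 2 = ∑ i, d i ^ 2 - c * ∑ i, b i * d i := by
    have : ∑ i, r i ^ 2 = ∑ i, d i ^ 2 - c * (∑ i, b i * d i) - c * ∑ i, b i * r i := by
      rw [Finset.mul_sum, Finset.mul_sum, ← Finset.sum_sub_distrib, ← Finset.sum_sub_distrib]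
      exact Finset.sum_congr rfl fun i _ => by simp only [hr]; ring
    rw [this, hbr]
    ring
  have had : ∀ a : Fin n → ℝ, ∑ i, a i * d i = c * (∑ i, a i * b i) + ∑ i, a i * r i := by
    intro a
    rw [Finset.mul_sum, ← Finset.sum_add_distrib]
    exact Finset.sum_congr rfl fun i _ => by simp only [hr]; ring
  have hmeas : Measurable fun z : ℝ × ℝ =>
      ENNReal.ofReal |c * z.1 + z.2| * gaussianPDF m 1 (-z.1) := by
    have := measurable_gaussianPDF m 1
    fun_prop
  have h1 : ∫⁻ a : Fin n → ℝ, ENNReal.ofReal |∑ i, a i * d i| * gaussianPDF m 1 (-∑ i, a i * b i)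
        ∂(Measure.pi fun _ => gaussianReal m 1)
      = ∫⁻ z : ℝ × ℝ, ENNReal.ofReal |c * z.1 + z.2| * gaussianPDF m 1 (-z.1)
        ∂((Measure.pi fun _ : Fin n => gaussianReal m 1).map
        (fun a => (∑ i, a i * b i, ∑ i, a i * r i))) := by
    rw [lintegral_map hmeas (by fun_prop)]
    simp_rw [had]
  have h2 : (↑(∑ i, d i ^ 2 - (∑ i, b i * d i) ^ 2 / (1 + s)).toNNReal : ℝ)
      = c ^ 2 * (s.toNNReal / (1 + s.toNNReal)) + (∑ i, r i ^ 2).toNNReal := by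
    rw [Real.coe_toNNReal _ hv.le, Real.coe_toNNReal _ hb.le,
      Real.coe_toNNReal _ (Finset.sum_nonneg fun i _ => sq_nonneg _), hrr, hc]
    field_simp
    ring
  have h3 := lintegral_abs_mul_gaussianPDF_neg m (m * ∑ i, b i) c (m * ∑ i, r i)
    (s := s.toNNReal) (r := (∑ i, r i ^ 2).toNNReal) (by simpa using hb) h2 (by simpa using hv)
  rw [h1, map_linear_pair_pi_gaussianReal m b r hbr, lintegral_prod _ hmeas.aemeasurable]
  have h4 : ∀ x : ℝ, ∫⁻ y, ENNReal.ofReal |c * x + y| * gaussianPDF m 1 (-x)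
      ∂gaussianReal (m * ∑ i, r i) (∑ i, r i ^ 2).toNNReal
      = (∫⁻ y, ENNReal.ofReal |c * x + y|
      ∂gaussianReal (m * ∑ i, r i) (∑ i, r i ^ 2).toNNReal) * gaussianPDF m 1 (-x) := fun x =>
    lintegral_mul_const _ (by fun_prop)
  simp_rw [h4]
  rw [h3, Real.coe_toNNReal _ hv.le, Real.coe_toNNReal _ hb.le, hsr]
  congr 3
  · ring
  · congr 2
    rw [hc]
    field_simp
    ring

end KacRiceDensity

section ClosedForms

lemma geom_sum_mul_one_sub (x : ℝ) (n : ℕ) :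
    (1 + ∑ i : Fin n, x ^ ((i : ℕ) + 1)) * (1 - x) = 1 - x ^ (n + 1) := by
  rw [Fin.sum_univ_eq_sum_range fun i => x ^ (i + 1)]
  induction n with
  | zero => simp
  | succ k ih => rw [Finset.sum_range_succ, ← add_assoc, add_mul, ih]; ring

lemma sum_succ_mul_pow_mul (x : ℝ) (n : ℕ) :
    (∑ i : Fin n, (((i : ℕ) + 1 : ℕ) : ℝ) * x ^ (i : ℕ)) * (1 - x) ^ 2
      = 1 - (n + 1) * x ^ n + n * x ^ (n + 1) := by
  rw [Fin.sum_univ_eq_sum_range fun i => ((i + 1 : ℕ) : ℝ) * x ^ i]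
  induction n with
  | zero => simp
  | succ k ih => rw [Finset.sum_range_succ, add_mul, ih]; push_cast; ring

lemma sum_succ_sq_mul_pow_mul (x : ℝ) (n : ℕ) :
    (∑ i : Fin n, (((i : ℕ) + 1 : ℕ) : ℝ) ^ 2 * x ^ (i : ℕ)) * (1 - x) ^ 3
      = 1 + x - (n + 1) ^ 2 * x ^ n + (2 * n ^ 2 + 2 * n - 1) * x ^ (n + 1)
        - n ^ 2 * x ^ (n + 2) := by
  rw [Fin.sum_univ_eq_sum_range fun i => ((i + 1 : ℕ) : ℝ) ^ 2 * x ^ i]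
  induction n with
  | zero => norm_num
  | succ k ih => rw [Finset.sum_range_succ, add_mul, ih]; push_cast; ring

/-- The value at level `0` of a normal density with squared standardised mean `V`, times the mean
absolute value of a unit normal with squared mean `W`. -/
noncomputable def levelMean (V W : ℝ) : ℝ := gaussianPDFReal 0 1 √V * absMean √W

lemma gaussianPDFReal_mul_absMean (M : ℝ) {A : ℝ≥0} (hA : A ≠ 0) (W : ℝ) :
    gaussianPDFReal M A 0 * absMean W = (√A)⁻¹ * levelMean (M ^ 2 / A) (W ^ 2) := by
  have hA0 : (0 : ℝ) < A := by positivity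
  rw [levelMean, Real.sqrt_sq_eq_abs, absMean_abs, gaussianPDFReal_zero_one, gaussianPDFReal,
    Real.sq_sqrt (by positivity), Real.sqrt_mul (by positivity), mul_inv]
  have : -(0 - M) ^ 2 / (2 * (A : ℝ)) = -(M ^ 2 / A) / 2 := by field_simp; ring
  rw [this]
  ring

lemma kacRice_density (m : ℝ) {n : ℕ} (hn : n ≠ 0) {t p q V : ℝ} (ht : t ≠ 0) (ht1 : 1 - t ≠ 0)
    (ht2 : 1 + t ≠ 0) (hτ1 : 1 - t ^ (n + 1) ≠ 0) (hτ2 : 1 + t ^ (n + 1) ≠ 0)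
    (hp : p = t / (1 - t ^ 2)) (hq : q = (n + 1) * t ^ (n + 1) / (1 - (t ^ (n + 1)) ^ 2))
    (hV : V = m ^ 2 * ((1 + t) / (1 - t)) * ((1 - t ^ (n + 1)) / (1 + t ^ (n + 1))))
    (hpq : q ^ 2 < p ^ 2) :
    ENNReal.ofReal |t| * ∫⁻ b : Fin n → ℝ,
        ENNReal.ofReal |∑ i, b i * (((i : ℕ) + 1 : ℕ) * t ^ (i : ℕ))|
          * gaussianPDF m 1 (-∑ i, b i * t ^ ((i : ℕ) + 1))
        ∂(Measure.pi fun _ => gaussianReal m 1)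
      = ENNReal.ofReal (√(p ^ 2 - q ^ 2) * levelMean V (V * ((p - q) / (p + q)))) := by
  set b : Fin n → ℝ := fun i => t ^ ((i : ℕ) + 1) with hbdef
  set d : Fin n → ℝ := fun i => (((i : ℕ) + 1 : ℕ) : ℝ) * t ^ (i : ℕ) with hddef
  set w := t ^ n with hw
  have hτ : t ^ (n + 1) = t * w := pow_succ' t n
  rw [hτ] at hq hV hτ1 hτ2
  have ht3 : 1 - t ^ 2 ≠ 0 := by
    rw [show 1 - t ^ 2 = (1 - t) * (1 + t) by ring]; exact mul_ne_zero ht1 ht2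
  have hτ3 : 1 - (t * w) ^ 2 ≠ 0 := by
    rw [show 1 - (t * w) ^ 2 = (1 - t * w) * (1 + t * w) by ring]; exact mul_ne_zero hτ1 hτ2
  have hS : 1 + ∑ i, b i = (1 - t * w) / (1 - t) := by
    rw [eq_div_iff ht1, ← hτ]
    exact geom_sum_mul_one_sub t n
  have hA : 1 + ∑ i, b i ^ 2 = (1 - (t * w) ^ 2) / (1 - t ^ 2) := by
    rw [eq_div_iff ht3, ← hτ, ← pow_mul, mul_comm (n + 1) 2, pow_mul,
      ← geom_sum_mul_one_sub (t ^ 2)]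
    refine congrArg (fun y => (1 + y) * (1 - t ^ 2)) (Finset.sum_congr rfl fun i _ => ?_)
    simp only [hbdef]
    rw [← pow_mul, ← pow_mul, mul_comm]
  have hD : ∑ i, d i = (1 - (n + 1) * w + n * (t * w)) / (1 - t) ^ 2 := by
    rw [eq_div_iff (pow_ne_zero 2 ht1), ← hτ]
    exact sum_succ_mul_pow_mul t n
  have hB : ∑ i, b i * d i
      = t * ((1 - (n + 1) * w ^ 2 + n * (t * w) ^ 2) / (1 - t ^ 2) ^ 2) := by
    have h1 : (t * w) ^ 2 = (t ^ 2) ^ (n + 1) := by rw [← hτ]; ring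
    have h2 : w ^ 2 = (t ^ 2) ^ n := by rw [hw]; ring
    rw [h1, h2, ← sum_succ_mul_pow_mul, mul_div_cancel_right₀ _ (pow_ne_zero 2 ht3), Finset.mul_sum]
    refine Finset.sum_congr rfl fun i _ => ?_
    simp only [hbdef, hddef]
    ring
  have hC : ∑ i, d i ^ 2 = (1 + t ^ 2 - (n + 1) ^ 2 * w ^ 2
      + (2 * n ^ 2 + 2 * n - 1) * (t * w) ^ 2 - n ^ 2 * (t ^ 2 * w) ^ 2) / (1 - t ^ 2) ^ 3 := by
    have h1 : (t * w) ^ 2 = (t ^ 2) ^ (n + 1) := by rw [← hτ]; ring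
    have h2 : w ^ 2 = (t ^ 2) ^ n := by rw [hw]; ring
    have h3 : (t ^ 2 * w) ^ 2 = (t ^ 2) ^ (n + 2) := by rw [hw]; ring
    rw [h1, h2, h3, ← sum_succ_sq_mul_pow_mul, mul_div_cancel_right₀ _ (pow_ne_zero 3 ht3)]
    refine Finset.sum_congr rfl fun i _ => ?_
    simp only [hddef]
    ring
  have hb0 : 0 < ∑ i, b i ^ 2 := by
    have : Nonempty (Fin n) := ⟨⟨0, Nat.pos_of_ne_zero hn⟩⟩
    refine Finset.sum_pos (fun i _ => ?_) Finset.univ_nonempty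
    positivity
  have hA0 : 0 < 1 + ∑ i, b i ^ 2 := by positivity
  set A := 1 + ∑ i, b i ^ 2 with hAdef
  have hpq1 : p + q ≠ 0 := fun h => by
    rw [eq_neg_of_add_eq_zero_left h, neg_sq] at hpq
    exact hpq.false
  have f1 : 1 - t ^ 2 = (1 - t) * (1 + t) := by ring
  have f2 : 1 - (t * w) ^ 2 = (1 - t * w) * (1 + t * w) := by ring
  have hv : ∑ i, d i ^ 2 - (∑ i, b i * d i) ^ 2 / A = A * (p ^ 2 - q ^ 2) / t ^ 2 := by
    rw [hC, hB, hA, hp, hq, f1, f2]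
    field_simp
    ring
  have hβ : ∑ i, d i - (∑ i, b i * d i) * (1 + ∑ i, b i) / A = (1 + ∑ i, b i) * (p - q) / t := by
    rw [hD, hB, hA, hS, hp, hq, f1, f2]
    obtain ⟨y, hy⟩ : ∃ y, y = t * w := ⟨_, rfl⟩
    rw [← hy] at hτ1 hτ2 ⊢
    field_simp
    rw [hy]
    ring
  have hvpos : 0 < A * (p ^ 2 - q ^ 2) / t ^ 2 := by
    have : 0 < p ^ 2 - q ^ 2 := by linarith
    positivity
  have hlem := lintegral_abs_linear_mul_gaussianPDF m b d hb0 (by rw [← hAdef, hv]; exact hvpos)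
  rw [← hAdef, hv, hβ] at hlem
  rw [hlem, ← ENNReal.ofReal_mul (abs_nonneg t)]
  congr 1
  have hAn : (1 + (∑ i, b i ^ 2).toNNReal : ℝ≥0) ≠ 0 := by positivity
  have hAc : ((1 + (∑ i, b i ^ 2).toNNReal : ℝ≥0) : ℝ) = A := by
    rw [NNReal.coe_add, NNReal.coe_one, Real.coe_toNNReal _ hb0.le]
  rw [mul_left_comm (gaussianPDFReal _ _ _), gaussianPDFReal_mul_absMean _ hAn, hAc]
  have e1 : (m * (1 + ∑ i, b i)) ^ 2 / A = V := by
    rw [hV, hS, hA, f1, f2]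
    field_simp
  have e2 : (m * ((1 + ∑ i, b i) * (p - q) / t) / √(A * (p ^ 2 - q ^ 2) / t ^ 2)) ^ 2
      = V * ((p - q) / (p + q)) := by
    have hpq2 : p - q ≠ 0 := fun h => by
      rw [sub_eq_zero.1 h] at hpq
      exact hpq.false
    rw [div_pow, Real.sq_sqrt hvpos.le, ← e1]
    rw [show p ^ 2 - q ^ 2 = (p - q) * (p + q) by ring]
    field_simp
  rw [e1, e2, Real.sqrt_div' _ (by positivity), Real.sqrt_mul hA0.le, Real.sqrt_sq_eq_abs]
  have : √A ≠ 0 := (Real.sqrt_pos.2 hA0).ne'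
  have : |t| ≠ 0 := by positivity
  field_simp

end ClosedForms

section ChangeOfVariables

lemma lintegral_eq_lintegral_exp (ρ : ℝ → ℝ≥0∞) :
    ∫⁻ t, ρ t = (∫⁻ x, ENNReal.ofReal (rexp x) * ρ (rexp x))
      + ∫⁻ x, ENNReal.ofReal (rexp x) * ρ (-rexp x) := by
  have h1 : ∫⁻ t in Ioi 0, ρ t = ∫⁻ x, ENNReal.ofReal (rexp x) * ρ (rexp x) := by
    have h := lintegral_image_eq_lintegral_abs_deriv_mul MeasurableSet.univ
      (fun x _ => (Real.hasDerivAt_exp x).hasDerivWithinAt) Real.exp_injective.injOn ρ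
    rw [image_univ, Real.range_exp] at h
    simpa [abs_of_pos (Real.exp_pos _)] using h
  have h2 : ∫⁻ t in Iio 0, ρ t = ∫⁻ x, ENNReal.ofReal (rexp x) * ρ (-rexp x) := by
    have h := lintegral_image_eq_lintegral_abs_deriv_mul MeasurableSet.univ
      (fun x _ => (Real.hasDerivAt_exp x).neg.hasDerivWithinAt)
      (fun x _ y _ hxy => Real.exp_injective (neg_injective hxy)) ρ
    have hr : (-Real.exp) '' univ = Iio 0 := by
      ext y
      simp only [image_univ, mem_range, Pi.neg_apply, mem_Iio]
      constructor
      · rintro ⟨x, rfl⟩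
        simpa using Real.exp_pos x
      · intro hy
        exact ⟨Real.log (-y), by rw [Real.exp_log (by linarith)]; ring⟩
    rw [hr] at h
    simpa [abs_of_pos (Real.exp_pos _)] using h
  rw [← h1, ← h2, ← lintegral_add_compl ρ measurableSet_Ioi (μ := volume) (A := Ioi 0), compl_Ioi,
    setLIntegral_congr (Iio_ae_eq_Iic (a := (0 : ℝ)))]

lemma lintegral_eq_two_mul_of_even {g h : ℝ → ℝ≥0∞} (h1 : ∀ x, 0 < x → g x = h x)
    (h2 : ∀ x, 0 < x → g (-x) = h x) : ∫⁻ x, g x = 2 * ∫⁻ x in Ioi 0, h x := by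
  rw [← lintegral_add_compl g measurableSet_Ioi (μ := volume) (A := Ioi 0), compl_Ioi,
    setLIntegral_congr_fun measurableSet_Ioi fun x hx => h1 x hx,
    ← setLIntegral_congr (Iio_ae_eq_Iic (a := (0 : ℝ))), two_mul]
  congr 1
  have h := lintegral_image_eq_lintegral_abs_deriv_mul (measurableSet_Ioi (a := (0 : ℝ)))
      (fun x _ => (hasDerivAt_neg x).hasDerivWithinAt) neg_injective.injOn g
  rw [image_neg_Ioi, neg_zero] at h
  rw [h]
  refine setLIntegral_congr_fun measurableSet_Ioi fun x hx => ?_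
  simp [h2 x hx]

lemma nat_mul_sinh_le {x : ℝ} (hx : 0 < x) {N : ℕ} (hN : 2 ≤ N) :
    N * sinh x < sinh (N * x) := by
  have hs := sinh_pos_iff.2 hx
  induction N, hN using Nat.le_induction with
  | base =>
    push_cast
    rw [sinh_two_mul]
    nlinarith [one_lt_cosh.2 hx.ne']
  | succ k hk ih =>
    push_cast
    rw [add_mul, one_mul, add_mul, one_mul, sinh_add]
    have hk0 : (0 : ℝ) < k := by exact_mod_cast (by omega : 0 < k)
    have h1 := one_lt_cosh.2 hx.ne'
    have h2 := one_lt_cosh.2 (mul_pos hk0 hx).ne'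
    nlinarith [sinh_pos_iff.2 (mul_pos hk0 hx)]

/-- `1 / sinh`. -/
noncomputable def csch (x : ℝ) : ℝ := 1 / sinh x

/-- The rescaling `N / sinh (N x)` of `1 / sinh x`. -/
noncomputable def cschScaled (N : ℕ) (x : ℝ) : ℝ := N / sinh (N * x)

/-- Kac's density in the centred case, in the logarithmic variable `x = log |t|`. -/
noncomputable def kacDensity (N : ℕ) (x : ℝ) : ℝ := √(csch x ^ 2 - cschScaled N x ^ 2) / 2

lemma cschScaled_pos {x : ℝ} (hx : 0 < x) {N : ℕ} (hN : 0 < N) : 0 < cschScaled N x := by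
  have : 0 < sinh (N * x) := sinh_pos_iff.2 (by positivity)
  unfold cschScaled
  positivity

lemma cschScaled_lt {x : ℝ} (hx : 0 < x) {N : ℕ} (hN : 2 ≤ N) : cschScaled N x < csch x := by
  have h1 := sinh_pos_iff.2 hx
  have h2 : 0 < sinh (N * x) := sinh_pos_iff.2 (by positivity)
  rw [csch, cschScaled, div_lt_div_iff₀ h2 h1]
  simpa using nat_mul_sinh_le hx hN

/-- The squared standardised mean of the polynomial at `t = exp (-x)`, with `N` iid normal
coefficients of mean `m` and variance `1`. -/
noncomputable def levelPos (m : ℝ) (N : ℕ) (x : ℝ) : ℝ :=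
  m ^ 2 * ((1 + rexp (-x)) / (1 - rexp (-x))) * ((1 - rexp (-(N * x))) / (1 + rexp (-(N * x))))

/-- The squared standardised mean of the polynomial at `t = -exp (-x)`, with `N` iid normal
coefficients of mean `m` and variance `1`. -/
noncomputable def levelNeg (m : ℝ) (N : ℕ) (x : ℝ) : ℝ :=
  m ^ 2 * ((1 - rexp (-x)) / (1 + rexp (-x)))
    * ((1 - (-1) ^ N * rexp (-(N * x))) / (1 + (-1) ^ N * rexp (-(N * x))))

/-- The density of zeros in `x = -log t`, `t > 0`. -/
noncomputable def densPos (m : ℝ) (N : ℕ) (x : ℝ) : ℝ :=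
  kacDensity N x * levelMean (levelPos m N x)
    (levelPos m N x * ((csch x - cschScaled N x) / (csch x + cschScaled N x)))

/-- The density of zeros in `x = -log (-t)`, `t < 0`. -/
noncomputable def densNeg (m : ℝ) (N : ℕ) (x : ℝ) : ℝ :=
  kacDensity N x * levelMean (levelNeg m N x)
    (levelNeg m N x * ((csch x + (-1) ^ N * cschScaled N x) / (csch x - (-1) ^ N * cschScaled N x)))

lemma exp_div_one_sub_sq (x : ℝ) : rexp x / (1 - rexp x ^ 2) = -(csch x / 2) := by
  have e : rexp x * rexp (-x) = 1 := by rw [← Real.exp_add]; simp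
  by_cases hx : x = 0
  · simp [hx, csch]
  rw [csch, sinh_eq]
  have h1 : 1 - rexp x ^ 2 ≠ 0 := by
    intro h
    have : rexp (2 * x) = 1 := by rw [two_mul, Real.exp_add]; nlinarith
    rw [Real.exp_eq_one_iff] at this
    exact hx (by linarith)
  have h2 : rexp (-x) = 1 / rexp x := by rw [Real.exp_neg]; simp
  rw [h2]
  have h3 : rexp x ^ 2 - 1 ≠ 0 := fun h => h1 (by linarith)
  have := Real.exp_pos x
  field_simp
  ring

lemma csch_neg (x : ℝ) : csch (-x) = -csch x := by simp [csch, div_neg]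

lemma kacRice_density_exp (m : ℝ) {n : ℕ} (hn : n ≠ 0) {x s : ℝ} (hx : x ≠ 0)
    (hs : s = 1 ∨ s = -1) {V : ℝ}
    (hV : V = m ^ 2 * ((1 + s * rexp x) / (1 - s * rexp x))
      * ((1 - (s * rexp x) ^ (n + 1)) / (1 + (s * rexp x) ^ (n + 1)))) :
    ENNReal.ofReal (rexp x) * ∫⁻ b : Fin n → ℝ,
        ENNReal.ofReal |∑ i, b i * (((i : ℕ) + 1 : ℕ) * (s * rexp x) ^ (i : ℕ))|
          * gaussianPDF m 1 (-∑ i, b i * (s * rexp x) ^ ((i : ℕ) + 1))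
        ∂(Measure.pi fun _ => gaussianReal m 1)
      = ENNReal.ofReal (kacDensity (n + 1) |x| * levelMean V (V *
          ((csch |x| - s ^ n * cschScaled (n + 1) |x|)
            / (csch |x| + s ^ n * cschScaled (n + 1) |x|)))) := by
  have hs2 : s ^ 2 = 1 := by rcases hs with rfl | rfl <;> norm_num
  have hs1 : |s| = 1 := by rcases hs with rfl | rfl <;> norm_num
  have hs0 : s ≠ 0 := by rcases hs with rfl | rfl <;> norm_num
  have habs : ∀ k : ℕ, k ≠ 0 → |(s * rexp x) ^ k| ≠ 1 := by
    intro k hk h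
    rw [abs_pow, abs_mul, hs1, one_mul, abs_of_pos (Real.exp_pos x), ← Real.exp_nat_mul,
      Real.exp_eq_one_iff] at h
    have : (k : ℝ) ≠ 0 := by exact_mod_cast hk
    exact mul_ne_zero this hx h
  have hne : ∀ y : ℝ, |y| ≠ 1 → 1 - y ≠ 0 ∧ 1 + y ≠ 0 := by
    intro y hy
    constructor <;> intro h <;> apply hy
    · rw [← sub_eq_zero.1 h]; simp
    · rw [eq_neg_of_add_eq_zero_right h]; simp
  have h1 := hne (s * rexp x) (by simpa only [pow_one] using habs 1 one_ne_zero)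
  have h2 := hne _ (habs (n + 1) n.succ_ne_zero)
  have ht : |s * rexp x| = rexp x := by rw [abs_mul, hs1, one_mul, abs_of_pos (Real.exp_pos x)]
  have hp : s * rexp x / (1 - (s * rexp x) ^ 2) = -(s * csch x / 2) := by
    rw [mul_pow, hs2, one_mul, mul_div_assoc, exp_div_one_sub_sq]
    ring
  have hsn2 : (s ^ (n + 1)) ^ 2 = 1 := by rw [← pow_mul, mul_comm, pow_mul, hs2, one_pow]
  have hexp : rexp x ^ (n + 1) = rexp ((n + 1 : ℕ) * x) := by rw [← Real.exp_nat_mul]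
  have hq : ((n : ℝ) + 1) * (s * rexp x) ^ (n + 1) / (1 - ((s * rexp x) ^ (n + 1)) ^ 2)
      = -(s ^ (n + 1) * cschScaled (n + 1) x / 2) := by
    rw [mul_pow, mul_pow (s ^ (n + 1)), hsn2, one_mul, hexp,
      show ((n : ℝ) + 1) * (s ^ (n + 1) * rexp ((n + 1 : ℕ) * x))
        / (1 - rexp ((n + 1 : ℕ) * x) ^ 2) = (n + 1) * s ^ (n + 1) * (rexp ((n + 1 : ℕ) * x)
        / (1 - rexp ((n + 1 : ℕ) * x) ^ 2)) by ring, exp_div_one_sub_sq, csch, cschScaled]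
    push_cast
    ring
  have hC : csch x ^ 2 = csch |x| ^ 2 := by
    rcases abs_choice x with h | h <;> rw [h]
    rw [csch_neg, neg_sq]
  have hneg : cschScaled (n + 1) (-x) = -cschScaled (n + 1) x := by
    simp [cschScaled, div_neg]
  have hQ : cschScaled (n + 1) x ^ 2 = cschScaled (n + 1) |x| ^ 2 := by
    rcases abs_choice x with h | h <;> rw [h]
    rw [hneg, neg_sq]
  have hlt := cschScaled_lt (abs_pos.2 hx) (N := n + 1) (by omega)
  have hQ0 := cschScaled_pos (abs_pos.2 hx) (N := n + 1) (by omega)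
  have hpq : (-(s ^ (n + 1) * cschScaled (n + 1) x / 2)) ^ 2 < (-(s * csch x / 2)) ^ 2 := by
    have : cschScaled (n + 1) |x| ^ 2 < csch |x| ^ 2 := by nlinarith
    rw [neg_sq, neg_sq, div_pow, div_pow, mul_pow, mul_pow, hsn2, hs2, hC, hQ]
    linarith
  have key := kacRice_density m hn (V := V) (mul_ne_zero hs0 (Real.exp_pos x).ne') h1.1 h1.2 h2.1
    h2.2 hp.symm hq.symm hV hpq
  rw [ht] at key
  rw [key]
  congr 2
  · rw [neg_sq, neg_sq, div_pow, div_pow, mul_pow, mul_pow, hsn2, hs2, hC, hQ, kacDensity, one_mul,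
      one_mul, ← sub_div, Real.sqrt_div' _ (by norm_num), show √((2 : ℝ) ^ 2) = 2 by simp]
  · congr 2
    have e1 : ∀ P Q : ℝ, (-(s * P / 2) - -(s ^ (n + 1) * Q / 2))
        / (-(s * P / 2) + -(s ^ (n + 1) * Q / 2)) = (P - s ^ n * Q) / (P + s ^ n * Q) := by
      intro P Q
      rw [pow_succ' s n,
        show -(s * P / 2) - -(s * s ^ n * Q / 2) = (-s / 2) * (P - s ^ n * Q) by ring,
        show -(s * P / 2) + -(s * s ^ n * Q / 2) = (-s / 2) * (P + s ^ n * Q) by ring,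
        mul_div_mul_left]
      simpa using hs0
    rw [e1]
    rcases abs_choice x with h | h <;> rw [h]
    rw [csch_neg, hneg, show -csch x - s ^ n * -cschScaled (n + 1) x
        = -(csch x - s ^ n * cschScaled (n + 1) x) by ring,
      show -csch x + s ^ n * -cschScaled (n + 1) x
        = -(csch x + s ^ n * cschScaled (n + 1) x) by ring, neg_div_neg_eq]

lemma one_sub_div_one_add_exp_neg {σ x : ℝ} (hσ : σ = 1 ∨ σ = -1) (hx : x ≠ 0) :
    (1 - σ * rexp (-x)) / (1 + σ * rexp (-x)) = -((1 - σ * rexp x) / (1 + σ * rexp x)) := by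
  have e : rexp x * rexp (-x) = 1 := by rw [← Real.exp_add]; simp
  have h1 : ∀ y, y ≠ 0 → 1 + σ * rexp y ≠ 0 := by
    intro y hy
    rcases hσ with rfl | rfl
    · positivity
    · intro h
      exact hy (Real.exp_eq_one_iff y |>.1 (by linarith))
  have hσ2 : σ ^ 2 = 1 := by rcases hσ with rfl | rfl <;> norm_num
  rw [← neg_div, div_eq_div_iff (h1 _ (neg_ne_zero.2 hx)) (h1 _ hx)]
  linear_combination -2 * e * σ ^ 2 - 2 * hσ2

/-- The expected number of zeros of a polynomial with iid normal coefficients, as an integral over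
the logarithmic variable. -/
theorem lintegral_encard_zeros_eq_dens (m : ℝ) {n : ℕ} (hn : n ≠ 0) :
    ∫⁻ a : Fin (n + 1) → ℝ, ({t : ℝ | ∑ i, a i * t ^ (i : ℕ) = 0}.encard : ℝ≥0∞)
        ∂(Measure.pi fun _ => gaussianReal m 1)
      = 2 * (∫⁻ x in Ioi 0, ENNReal.ofReal (densPos m (n + 1) x))
        + 2 * ∫⁻ x in Ioi 0, ENNReal.ofReal (densNeg m (n + 1) x) := by
  have einv : ∀ y : ℝ, rexp y * rexp (-y) = 1 := fun y => by rw [← Real.exp_add]; simp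
  rw [lintegral_encard_zeros_eq, lintegral_eq_lintegral_exp]
  congr 1
  · refine lintegral_eq_two_mul_of_even (fun x hx => ?_) fun x hx => ?_
    · have h := kacRice_density_exp m hn hx.ne' (Or.inl rfl) (V := levelPos m (n + 1) x) ?_
      · simpa [abs_of_pos hx, densPos] using h
      · rw [levelPos, one_mul, ← Real.exp_nat_mul, mul_assoc, mul_assoc]
        congr 1
        have r1 := one_sub_div_one_add_exp_neg (σ := -1) (Or.inr rfl) hx.ne'
        have r2 := one_sub_div_one_add_exp_neg (σ := 1) (Or.inl rfl)
          (x := ((n + 1 : ℕ) : ℝ) * x) (by positivity)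
        simp only [neg_mul, one_mul, sub_neg_eq_add, ← sub_eq_add_neg] at r1 r2
        rw [r1, r2, neg_mul_neg]
    · have h := kacRice_density_exp m hn (neg_ne_zero.2 hx.ne') (Or.inl rfl)
        (V := levelPos m (n + 1) x) ?_
      · simpa [abs_of_pos hx, densPos] using h
      · rw [levelPos, one_mul, ← Real.exp_nat_mul, mul_neg]
  · refine lintegral_eq_two_mul_of_even (fun x hx => ?_) fun x hx => ?_
    · have h := kacRice_density_exp m hn hx.ne' (Or.inr rfl) (V := levelNeg m (n + 1) x) ?_
      · simpa [abs_of_pos hx, densNeg, pow_succ, ← sub_eq_add_neg] using h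
      · have r1 := one_sub_div_one_add_exp_neg (σ := 1) (Or.inl rfl) hx.ne'
        have r2 := one_sub_div_one_add_exp_neg (σ := (-1) ^ (n + 1)) (neg_one_pow_eq_or ℝ _)
          (x := ((n + 1 : ℕ) : ℝ) * x) (by positivity)
        simp only [one_mul] at r1
        rw [levelNeg, r1, r2, mul_pow, ← Real.exp_nat_mul, neg_one_mul, ← sub_eq_add_neg,
          sub_neg_eq_add]
        ring
    · have h := kacRice_density_exp m hn (neg_ne_zero.2 hx.ne') (Or.inr rfl)
        (V := levelNeg m (n + 1) x) ?_
      · simpa [abs_of_pos hx, densNeg, pow_succ, ← sub_eq_add_neg] using h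
      · rw [levelNeg, mul_pow, ← Real.exp_nat_mul, mul_neg, neg_one_mul, ← sub_eq_add_neg,
          sub_neg_eq_add]

end ChangeOfVariables

section Hyperbolic

lemma one_add_sq_div_two_le_cosh (x : ℝ) : 1 + x ^ 2 / 2 ≤ cosh x := by
  have h : cosh x = 1 + 2 * sinh (x / 2) ^ 2 := by
    have h1 := cosh_two_mul (x / 2)
    rw [show 2 * (x / 2) = x by ring] at h1
    rw [h1, cosh_sq]
    ring
  have h2 : (x / 2) ^ 2 ≤ sinh (x / 2) ^ 2 := by
    rw [sq_le_sq]
    rw [Real.abs_sinh]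
    exact self_le_sinh_iff.2 (abs_nonneg _)
  rw [h]
  nlinarith

lemma add_cube_div_six_le_sinh {x : ℝ} (hx : 0 ≤ x) : x + x ^ 3 / 6 ≤ sinh x := by
  have h : MonotoneOn (fun y : ℝ => sinh y - (y + y ^ 3 / 6)) (Ici 0) := by
    refine monotoneOn_of_hasDerivWithinAt_nonneg (f' := fun y => cosh y - (1 + y ^ 2 / 2))
      (convex_Ici 0) (by fun_prop) (fun y _ => ?_) fun y _ => ?_
    · refine HasDerivAt.hasDerivWithinAt ?_
      refine ((hasDerivAt_sinh y).sub
        ((hasDerivAt_id' y).add ((hasDerivAt_pow 3 y).div_const 6))).congr_deriv ?_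
      push_cast
      ring
    · linarith [one_add_sq_div_two_le_cosh y]
  have := h self_mem_Ici hx hx
  simp at this
  linarith

lemma sinh_le_mul_cosh {x : ℝ} (hx : 0 ≤ x) : sinh x ≤ x * cosh x := by
  have h : MonotoneOn (fun y : ℝ => y * cosh y - sinh y) (Ici 0) := by
    refine monotoneOn_of_hasDerivWithinAt_nonneg (f' := fun y => y * sinh y)
      (convex_Ici 0) (by fun_prop) (fun y _ => ?_) fun y hy => ?_
    · refine HasDerivAt.hasDerivWithinAt ?_
      refine (((hasDerivAt_id' y).mul (hasDerivAt_cosh y)).sub (hasDerivAt_sinh y)).congr_deriv ?_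
      simp
    · rw [interior_Ici] at hy
      have := sinh_pos_iff.2 hy
      simp only [mem_Ioi] at hy
      positivity
  have := h self_mem_Ici hx hx
  simp at this
  linarith

lemma csch_pos {x : ℝ} (hx : 0 < x) : 0 < csch x := by
  have := sinh_pos_iff.2 hx
  unfold csch; positivity

lemma one_div_sq_sub_csch_sq_le {x : ℝ} (hx : 0 < x) : 1 / x ^ 2 - csch x ^ 2 ≤ 1 := by
  have hs := sinh_pos_iff.2 hx
  have h := sinh_le_mul_cosh hx.le
  have h2 : sinh x ^ 2 ≤ x ^ 2 * (sinh x ^ 2 + 1) := by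
    rw [← cosh_sq, ← mul_pow]
    exact pow_le_pow_left₀ hs.le h 2
  unfold csch
  rw [div_pow, one_pow, div_sub_div _ _ (by positivity) (by positivity), div_le_one (by positivity)]
  nlinarith

lemma le_one_div_sq_sub_csch_sq {x : ℝ} (hx : 0 < x) :
    1 / (3 + x ^ 2) ≤ 1 / x ^ 2 - csch x ^ 2 := by
  have hs := sinh_pos_iff.2 hx
  have h := add_cube_div_six_le_sinh hx.le
  have h1 : csch x ^ 2 ≤ 1 / (x ^ 2 * (1 + x ^ 2 / 3)) := by
    unfold csch
    rw [div_pow, one_pow]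
    refine one_div_le_one_div_of_le (by positivity) ?_
    calc x ^ 2 * (1 + x ^ 2 / 3) ≤ (x + x ^ 3 / 6) ^ 2 := by nlinarith [sq_nonneg (x ^ 3)]
      _ ≤ _ := pow_le_pow_left₀ (by positivity) h 2
  have h2 : 1 / x ^ 2 - 1 / (x ^ 2 * (1 + x ^ 2 / 3)) = 1 / (3 + x ^ 2) := by
    field_simp
    ring
  linarith

lemma csch_le_one_div {x : ℝ} (hx : 0 < x) : csch x ≤ 1 / x :=
  one_div_le_one_div_of_le hx (self_le_sinh_iff.2 hx.le)

lemma one_div_sub_csch_le {x : ℝ} (hx : 0 < x) : 1 / x - csch x ≤ x := by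
  have h1 := one_div_sq_sub_csch_sq_le hx
  have h2 := csch_le_one_div hx
  have h3 := csch_pos hx
  have h4 : (1 / x - csch x) * (1 / x) ≤ 1 := by
    have : 1 / x ^ 2 = (1 / x) ^ 2 := by simp
    nlinarith
  rw [mul_one_div, div_le_one hx] at h4
  exact h4

lemma csch_eq_exp (x : ℝ) : csch x = 2 * rexp (-x) / (1 - rexp (-x) ^ 2) := by
  have h := exp_div_one_sub_sq (-x)
  rw [csch_neg] at h
  rw [mul_div_assoc, h]
  ring

lemma mul_csch_le {x : ℝ} (hx : 0 < x) : x * csch x ≤ (1 + 2 * x) * rexp (-x) := by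
  have h0 : rexp (-x) ^ 2 ≤ 1 / (1 + 2 * x) := by
    rw [← Real.exp_nat_mul, show ((2 : ℕ) : ℝ) * -x = -(2 * x) by push_cast; ring, Real.exp_neg,
      ← one_div]
    exact one_div_le_one_div_of_le (by positivity) (by linarith [Real.add_one_le_exp (2 * x)])
  have h1 : 0 < 1 - rexp (-x) ^ 2 := by
    have : 1 / (1 + 2 * x) < 1 := by rw [div_lt_one (by positivity)]; linarith
    linarith
  rw [csch_eq_exp x, ← mul_div_assoc, div_le_iff₀ h1]
  have h2 : (1 + 2 * x) * rexp (-x) ^ 2 ≤ 1 := by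
    rw [le_div_iff₀ (by positivity)] at h0
    linarith
  nlinarith [Real.exp_pos (-x)]

variable {N : ℕ} {x : ℝ}

lemma cschScaled_eq (N : ℕ) (x : ℝ) : cschScaled N x = N * csch (N * x) := by
  simp [cschScaled, csch, div_eq_mul_inv]

lemma cschScaled_le_exp_mul_csch (hx : 0 < x) (hN : 2 ≤ N) :
    cschScaled N x ≤ 8 * rexp (-(N * x) / 4) * csch x := by
  have hN' : (2 : ℝ) ≤ N := by exact_mod_cast hN
  have hy : 0 < N * x := by positivity
  have h1 := mul_csch_le hy
  have hs := sinh_pos_iff.2 hx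
  have h2 : csch x * (x * rexp x) ≥ 1 := by
    have h3 : cosh x ≤ rexp x := by
      rw [← cosh_add_sinh]; linarith
    have h4 := sinh_le_mul_cosh hx.le
    unfold csch
    rw [one_div, ← div_eq_inv_mul, ge_iff_le, le_div_iff₀ hs]
    nlinarith
  have h5 : 1 + 2 * (N * x) ≤ 8 * rexp (N * x / 4) := by
    have := Real.add_one_le_exp (N * x / 4)
    linarith
  rw [cschScaled_eq]
  calc N * csch (N * x) = (N * x * csch (N * x)) * (1 / x) := by field_simp
    _ ≤ ((1 + 2 * (N * x)) * rexp (-(N * x))) * (csch x * rexp x) := by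
      have h6 : 1 / x ≤ csch x * rexp x := by
        rw [div_le_iff₀ hx]; linarith
      have := csch_pos hy
      gcongr
    _ ≤ (8 * rexp (N * x / 4) * rexp (-(N * x))) * (csch x * rexp (N * x / 2)) := by
      have := csch_pos hx
      gcongr
      nlinarith
    _ = 8 * (rexp (N * x / 4) * rexp (-(N * x)) * rexp (N * x / 2)) * csch x := by ring
    _ = _ := by
      rw [← Real.exp_add, ← Real.exp_add]
      congr 3
      ring

lemma csch_sq_sub_cschScaled_sq (hx : 0 < x) (hN : 0 < N) : csch x ^ 2 - cschScaled N x ^ 2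
    = N ^ 2 * (1 / (N * x) ^ 2 - csch (N * x) ^ 2) - (1 / x ^ 2 - csch x ^ 2) := by
  rw [cschScaled_eq]
  field_simp
  ring

lemma csch_sq_sub_cschScaled_sq_le (hx : 0 < x) (hN : 0 < N) :
    csch x ^ 2 - cschScaled N x ^ 2 ≤ N ^ 2 := by
  rw [csch_sq_sub_cschScaled_sq hx hN]
  have hN' : (0 : ℝ) < N := by exact_mod_cast hN
  have h1 := one_div_sq_sub_csch_sq_le (mul_pos hN' hx)
  have h2 := le_one_div_sq_sub_csch_sq hx
  have h3 : 0 < 1 / (3 + x ^ 2) := by positivity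
  nlinarith [sq_nonneg (N : ℝ)]

lemma le_csch_sq_sub_cschScaled_sq (hx : 0 < x) (hN : 0 < N) :
    N ^ 2 / (3 + (N * x) ^ 2) - 1 ≤ csch x ^ 2 - cschScaled N x ^ 2 := by
  rw [csch_sq_sub_cschScaled_sq hx hN]
  have hN' : (0 : ℝ) < N := by exact_mod_cast hN
  have h1 := le_one_div_sq_sub_csch_sq (mul_pos hN' hx)
  have h2 := one_div_sq_sub_csch_sq_le hx
  have h3 : (N : ℝ) ^ 2 / (3 + (N * x) ^ 2) = N ^ 2 * (1 / (3 + (N * x) ^ 2)) := by ring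
  rw [h3]
  nlinarith [mul_le_mul_of_nonneg_left h1 (sq_nonneg (N : ℝ))]

lemma kacDensity_nonneg (N : ℕ) (x : ℝ) : 0 ≤ kacDensity N x := by unfold kacDensity; positivity

lemma kacDensity_le (hx : 0 < x) (hN : 0 < N) : kacDensity N x ≤ N / 2 := by
  unfold kacDensity
  have := Real.sqrt_le_sqrt (csch_sq_sub_cschScaled_sq_le hx hN)
  rw [Real.sqrt_sq (by positivity)] at this
  linarith

lemma kacDensity_le_csch (hx : 0 < x) : kacDensity N x ≤ csch x / 2 := by
  unfold kacDensity
  have := Real.sqrt_le_sqrt (show csch x ^ 2 - cschScaled N x ^ 2 ≤ csch x ^ 2 by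
    nlinarith [sq_nonneg (cschScaled N x)])
  rw [Real.sqrt_sq (csch_pos hx).le] at this
  linarith

lemma csch_sub_kacDensity_le (hx : 0 < x) (hN : 2 ≤ N) :
    csch x / 2 - kacDensity N x ≤ cschScaled N x / 2 := by
  unfold kacDensity
  have h1 := cschScaled_lt hx hN
  have h2 := cschScaled_pos hx (by omega : 0 < N)
  have : csch x - cschScaled N x ≤ √(csch x ^ 2 - cschScaled N x ^ 2) := by
    apply Real.le_sqrt_of_sq_le
    nlinarith
  linarith

lemma abs_kacDensity_sub_le (hx : 0 < x) (hN : 2 ≤ N) :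
    |kacDensity N x - csch x / 2| ≤ 8 * rexp (-(N * x) / 4) * (csch x / 2) := by
  rw [abs_sub_comm, abs_of_nonneg (by linarith [kacDensity_le_csch (N := N) hx])]
  linarith [csch_sub_kacDensity_le hx hN, cschScaled_le_exp_mul_csch hx hN]

/-- `tanh (x / 2)` written with exponentials. -/
noncomputable def tanhHalf (x : ℝ) : ℝ := (1 - rexp (-x)) / (1 + rexp (-x))

lemma exp_neg_lt_one (hx : 0 < x) : rexp (-x) < 1 := by simpa using hx

lemma tanhHalf_pos (hx : 0 < x) : 0 < tanhHalf x :=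
  div_pos (by linarith [exp_neg_lt_one hx]) (by positivity)

lemma tanhHalf_le_one (x : ℝ) : tanhHalf x ≤ 1 := by
  unfold tanhHalf
  rw [div_le_one (by positivity)]
  linarith [Real.exp_pos (-x)]

lemma div_two_add_le_tanhHalf (hx : 0 < x) : x / (2 + x) ≤ tanhHalf x := by
  unfold tanhHalf
  have h : rexp (-x) * (1 + x) ≤ 1 := by
    rw [Real.exp_neg, inv_mul_le_one₀ (Real.exp_pos _)]
    linarith [Real.add_one_le_exp x]
  rw [div_le_div_iff₀ (by positivity) (by positivity)]
  nlinarith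

lemma tanhHalf_le (hx : 0 < x) : tanhHalf x ≤ x / 2 := by
  have h1 := sinh_le_mul_cosh (x := x / 2) (by positivity)
  rw [sinh_eq, cosh_eq] at h1
  have h2 : rexp (-(x / 2)) = rexp (x / 2) * rexp (-x) := by rw [← Real.exp_add]; congr 1; ring
  rw [h2] at h1
  unfold tanhHalf
  rw [div_le_iff₀ (by positivity)]
  have h3 := Real.exp_pos (x / 2)
  refine le_of_mul_le_mul_left ?_ h3
  nlinarith

lemma csch_mul_tanhHalf_le (hx : 0 < x) : csch x / 2 * tanhHalf x ≤ 1 / 4 := by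
  have h := exp_neg_lt_one hx
  have h1 : csch x / 2 * tanhHalf x = rexp (-x) / (1 + rexp (-x)) ^ 2 := by
    rw [csch_eq_exp x, tanhHalf]
    have : 1 - rexp (-x) ^ 2 ≠ 0 := by nlinarith [Real.exp_pos (-x)]
    have h3 : 1 + rexp (-x) ≠ 0 := by positivity
    rw [show 1 - rexp (-x) ^ 2 = (1 - rexp (-x)) * (1 + rexp (-x)) by ring]
    have h2 : 1 - rexp (-x) ≠ 0 := by linarith
    field_simp
  rw [h1, div_le_div_iff₀ (by positivity) (by positivity)]
  nlinarith [sq_nonneg (1 - rexp (-x))]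

end Hyperbolic

section DensityEstimates

lemma gaussianPDFReal_zero_one_sqrt {V : ℝ} (hV : 0 ≤ V) :
    gaussianPDFReal 0 1 √V = gaussianPDFReal 0 1 0 * rexp (-V / 2) := by
  simp [gaussianPDFReal_zero_one, Real.sq_sqrt hV]

lemma gaussianPDFReal_zero_one_zero_nonneg : 0 ≤ gaussianPDFReal 0 1 0 :=
  gaussianPDFReal_nonneg _ _ _

lemma gaussianPDFReal_zero_one_zero_sq_le : gaussianPDFReal 0 1 0 ^ 2 ≤ 1 / 4 := by
  nlinarith [gaussianPDFReal_zero_one_zero_le, gaussianPDFReal_zero_one_zero_nonneg]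

lemma levelMean_nonneg (V W : ℝ) : 0 ≤ levelMean V W :=
  mul_nonneg (gaussianPDFReal_nonneg _ _ _) (absMean_nonneg _)

lemma levelMean_zero_zero : levelMean 0 0 = 1 / π := by
  rw [levelMean, Real.sqrt_zero, absMean_zero, ← two_mul_gaussianPDFReal_zero_one_zero_sq]
  ring

lemma abs_levelMean_sub_right {V W W' : ℝ} (hV : 0 ≤ V) (hW : 0 ≤ W) (hW' : 0 ≤ W') :
    |levelMean V W - levelMean V W'| ≤ 1 / 4 * rexp (-V / 2) * |W - W'| := by
  have h := abs_absMean_sqrt_sub_le hW hW'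
  have h0 := gaussianPDFReal_zero_one_zero_nonneg
  rw [levelMean, levelMean, ← mul_sub, abs_mul, abs_of_nonneg (gaussianPDFReal_nonneg _ _ _),
    gaussianPDFReal_zero_one_sqrt hV]
  calc gaussianPDFReal 0 1 0 * rexp (-V / 2) * |absMean √W - absMean √W'|
      ≤ gaussianPDFReal 0 1 0 * rexp (-V / 2) * (gaussianPDFReal 0 1 0 * |W - W'|) := by gcongr
    _ = gaussianPDFReal 0 1 0 ^ 2 * rexp (-V / 2) * |W - W'| := by ring
    _ ≤ _ := by gcongr; exact gaussianPDFReal_zero_one_zero_sq_le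

lemma absMean_sqrt_le {W : ℝ} (hW : 0 ≤ W) : absMean √W ≤ gaussianPDFReal 0 1 0 * (2 + W) := by
  have h := (abs_le.1 (abs_absMean_sqrt_sub_le hW le_rfl)).2
  rw [Real.sqrt_zero, absMean_zero, sub_zero, abs_of_nonneg hW] at h
  linarith

lemma abs_levelMean_sub_left {V V' W : ℝ} (hV : 0 ≤ V) (hV' : 0 ≤ V') (hW : 0 ≤ W) :
    |levelMean V W - levelMean V' W| ≤ 1 / 4 * |rexp (-V / 2) - rexp (-V' / 2)| * (2 + W) := by
  have h := absMean_sqrt_le hW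
  have h0 := gaussianPDFReal_zero_one_zero_nonneg
  rw [levelMean, levelMean, ← sub_mul, abs_mul, abs_of_nonneg (absMean_nonneg _),
    gaussianPDFReal_zero_one_sqrt hV, gaussianPDFReal_zero_one_sqrt hV', ← mul_sub, abs_mul,
    abs_of_nonneg h0]
  calc gaussianPDFReal 0 1 0 * |rexp (-V / 2) - rexp (-V' / 2)| * absMean √W
      ≤ gaussianPDFReal 0 1 0 * |rexp (-V / 2) - rexp (-V' / 2)|
        * (gaussianPDFReal 0 1 0 * (2 + W)) := by gcongr
    _ = gaussianPDFReal 0 1 0 ^ 2 * |rexp (-V / 2) - rexp (-V' / 2)| * (2 + W) := by ring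
    _ ≤ _ := by gcongr; exact gaussianPDFReal_zero_one_zero_sq_le

lemma levelMean_le {V W : ℝ} (hV : 0 ≤ V) (hW : 0 ≤ W) :
    levelMean V W ≤ 1 / 4 * rexp (-V / 2) * (2 + W) := by
  have h := absMean_sqrt_le hW
  have h0 := gaussianPDFReal_zero_one_zero_nonneg
  rw [levelMean, gaussianPDFReal_zero_one_sqrt hV]
  calc gaussianPDFReal 0 1 0 * rexp (-V / 2) * absMean √W
      ≤ gaussianPDFReal 0 1 0 * rexp (-V / 2) * (gaussianPDFReal 0 1 0 * (2 + W)) := by gcongr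
    _ = gaussianPDFReal 0 1 0 ^ 2 * rexp (-V / 2) * (2 + W) := by ring
    _ ≤ _ := by gcongr; exact gaussianPDFReal_zero_one_zero_sq_le

lemma abs_exp_neg_sub_exp_neg_le {a b c : ℝ} (ha : c ≤ a) (hb : c ≤ b) :
    |rexp (-a) - rexp (-b)| ≤ rexp (-c) * |a - b| := by
  wlog hab : a ≤ b generalizing a b
  · rw [abs_sub_comm, abs_sub_comm a]
    exact this hb ha (le_of_not_ge hab)
  have h1 : rexp (-b) = rexp (-a) * rexp (-(b - a)) := by rw [← Real.exp_add]; congr 1; ring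
  have h2 := Real.add_one_le_exp (-(b - a))
  have h3 : rexp (-b) ≤ rexp (-a) := Real.exp_le_exp.2 (by linarith)
  have h4 : rexp (-a) ≤ rexp (-c) := Real.exp_le_exp.2 (by linarith)
  rw [abs_of_nonneg (by linarith), abs_sub_comm, abs_of_nonneg (by linarith)]
  calc rexp (-a) - rexp (-b) = rexp (-a) * (1 - rexp (-(b - a))) := by rw [h1]; ring
    _ ≤ rexp (-a) * (b - a) := mul_le_mul_of_nonneg_left (by linarith) (Real.exp_pos _).le
    _ ≤ _ := mul_le_mul_of_nonneg_right h4 (by linarith)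

lemma abs_levelMean_sub_one_div_pi_le {V W : ℝ} (hV : 0 ≤ V) (hW : 0 ≤ W) :
    |levelMean V W - 1 / π| ≤ (V + W) / 4 := by
  have h1 := abs_levelMean_sub_right hV hW le_rfl
  have h2 := abs_levelMean_sub_left hV le_rfl (le_refl (0 : ℝ))
  have h3 := abs_exp_neg_sub_exp_neg_le (a := V / 2) (b := 0) (c := 0) (by positivity) le_rfl
  have h4 : rexp (-V / 2) ≤ 1 := Real.exp_le_one_iff.2 (by linarith)
  simp only [neg_zero, Real.exp_zero, sub_zero, abs_of_nonneg (show 0 ≤ V / 2 by positivity),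
    zero_div, add_zero, one_mul, abs_of_nonneg hW, ← neg_div] at h1 h2 h3
  rw [levelMean_zero_zero] at h2
  have h5 := abs_sub_le (levelMean V W) (levelMean V 0) (1 / π)
  nlinarith

lemma one_add_pow_three_mul_exp_le {V : ℝ} (hV : 0 ≤ V) :
    (1 + V) ^ 3 * rexp (-V / 4) ≤ 1728 := by
  have h1 : 1 + V ≤ 12 * rexp (V / 12) := by linarith [Real.add_one_le_exp (V / 12)]
  have h2 : (1 + V) ^ 3 ≤ 1728 * rexp (V / 4) := by
    calc (1 + V) ^ 3 ≤ (12 * rexp (V / 12)) ^ 3 := by gcongr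
      _ = _ := by
        rw [mul_pow, ← Real.exp_nat_mul]
        norm_num
        ring
  calc (1 + V) ^ 3 * rexp (-V / 4) ≤ 1728 * rexp (V / 4) * rexp (-V / 4) := by gcongr
    _ = 1728 := by rw [mul_assoc, ← Real.exp_add]; simp [neg_div]

lemma abs_levelMean_mul_sub_le {V ρ τ δ : ℝ} (hV : 0 ≤ V) (hρ : 1 / 2 ≤ ρ) (hτ : 0 ≤ τ)
    (hτ4 : τ ≤ 4) (hρδ : |ρ - 1| ≤ δ) (hτδ : |τ - 1| ≤ δ) :
    |levelMean (V * ρ) (V * τ) - levelMean V V| ≤ δ * (V * (1 + V) * rexp (-V / 4)) := by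
  have hδ : 0 ≤ δ := (abs_nonneg _).trans hρδ
  have hρ0 : 0 ≤ ρ := by linarith
  have h1 := abs_levelMean_sub_left (V := V * ρ) (V' := V) (W := V * τ) (by positivity) hV
    (by positivity)
  have h2 := abs_levelMean_sub_right (V := V) (W := V * τ) (W' := V) hV (by positivity) hV
  have h3 := abs_exp_neg_sub_exp_neg_le (a := V * ρ / 2) (b := V / 2) (c := V / 4)
    (by nlinarith) (by linarith)
  have h4 : |V * ρ / 2 - V / 2| ≤ V * δ / 2 := by
    rw [show V * ρ / 2 - V / 2 = V / 2 * (ρ - 1) by ring, abs_mul, abs_of_nonneg (by positivity)]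
    nlinarith
  have h5 : |V * τ - V| ≤ V * δ := by
    rw [show V * τ - V = V * (τ - 1) by ring, abs_mul, abs_of_nonneg (by positivity)]
    nlinarith
  have h6 : rexp (-V / 2) ≤ rexp (-V / 4) := Real.exp_le_exp.2 (by linarith)
  simp only [← neg_div] at h3
  have h7 := abs_sub_le (levelMean (V * ρ) (V * τ)) (levelMean V (V * τ)) (levelMean V V)
  calc _ ≤ _ := h7
    _ ≤ 1 / 4 * (rexp (-V / 4) * (V * δ / 2)) * (2 + V * 4)
        + 1 / 4 * rexp (-V / 4) * (V * δ) := by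
      refine add_le_add (h1.trans ?_) (h2.trans ?_)
      · gcongr
        exact h3.trans (by gcongr)
      · gcongr
    _ ≤ _ := by
      have : 0 ≤ δ * V * (1 + V) * rexp (-V / 4) := by positivity
      have : 0 ≤ δ * V * rexp (-V / 4) := by positivity
      nlinarith

variable {N : ℕ} {x m : ℝ}

/-- The limiting density on the positive half-line. -/
noncomputable def limPos (m x : ℝ) : ℝ :=
  csch x / 2 * levelMean (m ^ 2 / tanhHalf x) (m ^ 2 / tanhHalf x)

/-- The limiting density on the negative half-line. -/
noncomputable def limNeg (m x : ℝ) : ℝ :=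
  csch x / 2 * levelMean (m ^ 2 * tanhHalf x) (m ^ 2 * tanhHalf x)

lemma abs_one_sub_div_one_add_sub_one_le {r : ℝ} (hr : |r| ≤ 1 / 4) :
    |(1 - r) / (1 + r) - 1| ≤ 4 * |r| := by
  have h := abs_le.1 hr
  have h1 : 0 < 1 + r := by linarith
  rw [show (1 - r) / (1 + r) - 1 = -2 * r / (1 + r) by field_simp; ring, abs_div,
    abs_of_pos h1, div_le_iff₀ h1, abs_mul]
  norm_num
  nlinarith [abs_nonneg r]

lemma levelRatio_bounds {s t : ℝ} (hs : |s| = 1) (ht : |t| = 1) (hx : 0 < x) (hN : 2 ≤ N)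
    (hy : 16 ≤ N * x) {ρ τ : ℝ} (hρ : ρ = (1 - s * rexp (-(N * x))) / (1 + s * rexp (-(N * x))))
    (hτ : τ = ρ * ((csch x - t * cschScaled N x) / (csch x + t * cschScaled N x))) :
    1 / 2 ≤ ρ ∧ ρ ≤ 2 ∧ 0 ≤ τ ∧ τ ≤ 4 ∧ |ρ - 1| ≤ 40 * rexp (-(N * x) / 4) ∧
      |τ - 1| ≤ 40 * rexp (-(N * x) / 4) := by
  have hP := csch_pos hx
  have hQ := cschScaled_pos hx (by omega : 0 < N)
  have hQP := cschScaled_le_exp_mul_csch hx hN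
  set δ := rexp (-(N * x) / 4) with hδ
  have hδ0 : 0 < δ := Real.exp_pos _
  have hδ1 : δ ≤ 1 / 40 := by
    have h1 : δ ≤ rexp (-4) := Real.exp_le_exp.2 (by linarith)
    have h2 : rexp (-4) = (rexp (-1)) ^ 4 := by rw [← Real.exp_nat_mul]; norm_num
    have h3 : rexp (-1) ≤ 1 / 2.6 := by
      rw [Real.exp_neg, ← one_div]
      exact one_div_le_one_div_of_le (by norm_num) (by linarith [Real.exp_one_gt_d9])
    have h4 : rexp (-1) ^ 4 ≤ (1 / 2.6) ^ 4 := pow_le_pow_left₀ (Real.exp_pos _).le h3 4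
    norm_num at h4
    linarith
  have hf : rexp (-(N * x)) ≤ δ := Real.exp_le_exp.2 (by linarith)
  have hf0 := Real.exp_pos (-(N * x))
  set f := rexp (-(N * x)) with hfdef
  set q := cschScaled N x / csch x with hq
  have hq0 : 0 < q := by positivity
  have hq1 : q ≤ 8 * δ := by rw [hq, div_le_iff₀ hP]; exact hQP
  have hσ : (csch x - t * cschScaled N x) / (csch x + t * cschScaled N x)
      = (1 - t * q) / (1 + t * q) := by
    rw [hq]
    have : (csch x - t * cschScaled N x) = csch x * (1 - t * (cschScaled N x / csch x)) := by
      field_simp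
    rw [this]
    have : (csch x + t * cschScaled N x) = csch x * (1 + t * (cschScaled N x / csch x)) := by
      field_simp
    rw [this, mul_div_mul_left _ _ hP.ne']
  rw [hσ] at hτ
  have hsf : |s * f| = f := by rw [abs_mul, hs, one_mul, abs_of_pos hf0]
  have htq : |t * q| = q := by rw [abs_mul, ht, one_mul, abs_of_pos hq0]
  have h1 := abs_one_sub_div_one_add_sub_one_le (r := s * f) (by rw [hsf]; linarith)
  have h2 := abs_one_sub_div_one_add_sub_one_le (r := t * q) (by rw [htq]; linarith)
  rw [← hρ, hsf] at h1
  rw [htq] at h2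
  set σ := (1 - t * q) / (1 + t * q)
  have h3 : |ρ - 1| ≤ 4 * δ := by linarith
  have h4 : |σ - 1| ≤ 32 * δ := by linarith
  have h5 := abs_le.1 h3
  have h6 := abs_le.1 h4
  have h7 : 0 ≤ ρ := by linarith
  have h8 : 0 ≤ σ := by linarith
  refine ⟨by linarith, by linarith, by rw [hτ]; positivity, by rw [hτ]; nlinarith, by linarith, ?_⟩
  rw [hτ, show ρ * σ - 1 = (ρ - 1) * σ + (σ - 1) by ring]
  refine (abs_add_le _ _).trans ?_
  rw [abs_mul, abs_of_nonneg h8]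
  nlinarith [abs_nonneg (ρ - 1)]

lemma levelPos_eq (hx : 0 < x) : levelPos m N x =
    m ^ 2 / tanhHalf x * ((1 - 1 * rexp (-(N * x))) / (1 + 1 * rexp (-(N * x)))) := by
  have := exp_neg_lt_one hx
  have : 1 - rexp (-x) ≠ 0 := by linarith
  rw [levelPos, tanhHalf]
  field_simp

lemma levelNeg_eq : levelNeg m N x = m ^ 2 * tanhHalf x
    * ((1 - (-1) ^ N * rexp (-(N * x))) / (1 + (-1) ^ N * rexp (-(N * x)))) := by
  rw [levelNeg, tanhHalf]

lemma csch_div_two_le_div (hm : m ≠ 0) (hx : 0 < x) :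
    csch x / 2 ≤ 1 / (4 * m ^ 2) * (m ^ 2 / tanhHalf x) := by
  have h := csch_mul_tanhHalf_le hx
  have ht := tanhHalf_pos hx
  have : 1 / (4 * m ^ 2) * (m ^ 2 / tanhHalf x) = 1 / 4 / tanhHalf x := by field_simp
  rw [this, le_div_iff₀ ht]
  exact h

lemma abs_densPos_sub_limPos_le_of_le (hm : m ≠ 0) (hx : 0 < x) (hN : 2 ≤ N) (hy : 16 ≤ N * x) :
    |densPos m N x - limPos m x| ≤ 20736 / m ^ 2 * rexp (-(N * x) / 4) := by
  obtain ⟨h1, h2, h3, h4, h5, h6⟩ := levelRatio_bounds (s := 1) (t := 1) (by simp) (by simp)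
    hx hN hy rfl rfl
  set ρ := (1 - 1 * rexp (-(N * x))) / (1 + 1 * rexp (-(N * x)))
  set τ := ρ * ((csch x - 1 * cschScaled N x) / (csch x + 1 * cschScaled N x)) with hτ
  set δ := rexp (-(N * x) / 4)
  have hδ0 : 0 < δ := Real.exp_pos _
  set V := m ^ 2 / tanhHalf x with hVdef
  have ht := tanhHalf_pos hx
  have hV : 0 ≤ V := by positivity
  have hp := csch_div_two_le_div hm hx
  have hp0 : 0 < csch x / 2 := by linarith [csch_pos hx]
  rw [← hVdef] at hp
  set p := csch x / 2
  have hdens : densPos m N x = kacDensity N x * levelMean (V * ρ) (V * τ) := by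
    rw [densPos, levelPos_eq hx, hτ]
    simp only [one_mul]
    rw [← mul_assoc V]
    simp only [ρ, V, one_mul]
  have hK := abs_kacDensity_sub_le hx hN
  have hA := abs_levelMean_mul_sub_le hV h1 h3 h4 h5 h6
  have hB := levelMean_le (V := V * ρ) (W := V * τ) (by positivity) (by positivity)
  have hB0 := levelMean_nonneg (V * ρ) (V * τ)
  have hE := Real.exp_pos (-V / 4)
  have hB' : levelMean (V * ρ) (V * τ) ≤ 1 / 4 * rexp (-V / 4) * (2 + 4 * V) := by
    refine hB.trans ?_
    have : rexp (-(V * ρ) / 2) ≤ rexp (-V / 4) := Real.exp_le_exp.2 (by nlinarith)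
    gcongr 1 / 4 * ?_ * (2 + ?_)
    nlinarith
  have h1728 := one_add_pow_three_mul_exp_le hV
  have hpoly : V * (4 + 48 * V + 40 * V ^ 2) ≤ 48 * (1 + V) ^ 3 := by
    nlinarith [mul_nonneg hV hV, mul_nonneg hV (mul_nonneg hV hV)]
  rw [hdens, limPos, ← hVdef, show kacDensity N x * levelMean (V * ρ) (V * τ) - p * levelMean V V
    = (kacDensity N x - p) * levelMean (V * ρ) (V * τ)
      + p * (levelMean (V * ρ) (V * τ) - levelMean V V) by ring]
  refine (abs_add_le _ _).trans ?_
  rw [abs_mul, abs_mul, abs_of_nonneg hB0, abs_of_pos hp0]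
  calc _ ≤ 8 * δ * p * (1 / 4 * rexp (-V / 4) * (2 + 4 * V))
        + p * (40 * δ * (V * (1 + V) * rexp (-V / 4))) := by gcongr
    _ = p * (δ * rexp (-V / 4) * (4 + 48 * V + 40 * V ^ 2)) := by ring
    _ ≤ (1 / (4 * m ^ 2) * V) * (δ * rexp (-V / 4) * (4 + 48 * V + 40 * V ^ 2)) := by gcongr
    _ = 1 / (4 * m ^ 2) * δ * (rexp (-V / 4) * (V * (4 + 48 * V + 40 * V ^ 2))) := by ring
    _ ≤ 1 / (4 * m ^ 2) * δ * (rexp (-V / 4) * (48 * (1 + V) ^ 3)) :=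
      mul_le_mul_of_nonneg_left (mul_le_mul_of_nonneg_left hpoly hE.le) (by positivity)
    _ = 1 / (4 * m ^ 2) * δ * 48 * ((1 + V) ^ 3 * rexp (-V / 4)) := by ring
    _ ≤ 1 / (4 * m ^ 2) * δ * 48 * 1728 := by gcongr
    _ = _ := by field_simp; ring

lemma abs_densNeg_sub_limNeg_le_of_le (hx : 0 < x) (hN : 2 ≤ N) (hy : 16 ≤ N * x) :
    |densNeg m N x - kacDensity N x / π - (limNeg m x - csch x / 2 / π)|
      ≤ 17283 * m ^ 2 * rexp (-(N * x) / 4) := by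
  obtain ⟨h1, h2, h3, h4, h5, h6⟩ := levelRatio_bounds (s := (-1) ^ N) (t := -(-1) ^ N)
    (by simp) (by simp) hx hN hy rfl rfl
  set ρ := (1 - (-1) ^ N * rexp (-(N * x))) / (1 + (-1) ^ N * rexp (-(N * x))) with hρ
  set τ := ρ * ((csch x - -(-1) ^ N * cschScaled N x) / (csch x + -(-1) ^ N * cschScaled N x))
    with hτ
  set δ := rexp (-(N * x) / 4)
  have hδ0 : 0 < δ := Real.exp_pos _
  set V := m ^ 2 * tanhHalf x with hVdef
  have ht := tanhHalf_pos hx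
  have hV : 0 ≤ V := by positivity
  have hp0 : 0 < csch x / 2 := by linarith [csch_pos hx]
  have hp : csch x / 2 * V ≤ m ^ 2 / 4 := by
    have := csch_mul_tanhHalf_le hx
    rw [hVdef]
    nlinarith [sq_nonneg m]
  set p := csch x / 2
  have hdens : densNeg m N x = kacDensity N x * levelMean (V * ρ) (V * τ) := by
    rw [densNeg, levelNeg_eq, hτ, ← hρ, ← hVdef, ← mul_assoc V, neg_mul, sub_neg_eq_add,
      ← sub_eq_add_neg]
  have hK := abs_kacDensity_sub_le hx hN
  have hA := abs_levelMean_mul_sub_le hV h1 h3 h4 h5 h6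
  have hB := abs_levelMean_sub_one_div_pi_le (V := V * ρ) (W := V * τ) (by positivity)
    (by positivity)
  have hE := Real.exp_pos (-V / 4)
  have hB' : |levelMean (V * ρ) (V * τ) - 1 / π| ≤ 6 / 4 * V := by
    refine hB.trans ?_
    nlinarith
  have h1728 := one_add_pow_three_mul_exp_le hV
  rw [hdens, limNeg, ← hVdef, show kacDensity N x * levelMean (V * ρ) (V * τ)
      - kacDensity N x / π - (p * levelMean V V - p / π)
    = (kacDensity N x - p) * (levelMean (V * ρ) (V * τ) - 1 / π)
      + p * (levelMean (V * ρ) (V * τ) - levelMean V V) by ring]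
  refine (abs_add_le _ _).trans ?_
  rw [abs_mul, abs_mul, abs_of_pos hp0]
  calc _ ≤ 8 * δ * p * (6 / 4 * V) + p * (40 * δ * (V * (1 + V) * rexp (-V / 4))) := by gcongr
    _ = (p * V) * (δ * (12 + 40 * ((1 + V) * rexp (-V / 4)))) := by ring
    _ ≤ (m ^ 2 / 4) * (δ * (12 + 40 * ((1 + V) ^ 3 * rexp (-V / 4)))) := by
      gcongr
      exact le_self_pow₀ (by linarith) (by norm_num)
    _ ≤ (m ^ 2 / 4) * (δ * (12 + 40 * 1728)) := by gcongr
    _ = _ := by ring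

lemma csch_ratio_le_one (hx : 0 < x) (hN : 2 ≤ N) :
    0 ≤ (csch x - cschScaled N x) / (csch x + cschScaled N x) ∧
    (csch x - cschScaled N x) / (csch x + cschScaled N x) ≤ 1 := by
  have h1 := cschScaled_lt hx hN
  have h2 := cschScaled_pos hx (by omega : 0 < N)
  exact ⟨div_nonneg (by linarith) (by linarith), by rw [div_le_one (by linarith)]; linarith⟩

lemma limPos_nonneg (hx : 0 < x) : 0 ≤ limPos m x :=
  mul_nonneg (by linarith [csch_pos hx]) (levelMean_nonneg _ _)

lemma densPos_nonneg : 0 ≤ densPos m N x :=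
  mul_nonneg (kacDensity_nonneg _ _) (levelMean_nonneg _ _)

lemma densNeg_nonneg : 0 ≤ densNeg m N x :=
  mul_nonneg (kacDensity_nonneg _ _) (levelMean_nonneg _ _)

lemma mul_levelMean_le {V W : ℝ} (hV : 0 ≤ V) (hW : 0 ≤ W) (hWV : W ≤ V) :
    V * levelMean V W ≤ 864 := by
  have h1 := levelMean_le hV hW
  have h2 := one_add_pow_three_mul_exp_le hV
  have h3 : rexp (-V / 2) ≤ rexp (-V / 4) := Real.exp_le_exp.2 (by linarith)
  have hE := Real.exp_pos (-V / 4)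
  calc V * levelMean V W ≤ V * (1 / 4 * rexp (-V / 4) * (2 + V)) := by
        gcongr
        exact h1.trans (by gcongr)
    _ = 1 / 2 * rexp (-V / 4) * (V * (2 + V) / 2) := by ring
    _ ≤ 1 / 2 * rexp (-V / 4) * (1 + V) ^ 3 := by
      gcongr
      nlinarith [mul_nonneg hV hV, mul_nonneg hV (mul_nonneg hV hV)]
    _ ≤ _ := by linarith

lemma limPos_le (hm : m ≠ 0) (hx : 0 < x) : limPos m x ≤ 216 / m ^ 2 := by
  have ht := tanhHalf_pos hx
  have hp := csch_div_two_le_div hm hx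
  have h := mul_levelMean_le (V := m ^ 2 / tanhHalf x) (by positivity) (by positivity) le_rfl
  calc limPos m x ≤ 1 / (4 * m ^ 2) * (m ^ 2 / tanhHalf x)
        * levelMean (m ^ 2 / tanhHalf x) (m ^ 2 / tanhHalf x) :=
      mul_le_mul_of_nonneg_right hp (levelMean_nonneg _ _)
    _ ≤ 1 / (4 * m ^ 2) * 864 := by rw [mul_assoc]; gcongr
    _ = _ := by field_simp; norm_num

lemma densPos_le (hm : m ≠ 0) (hx : 0 < x) (hN : 2 ≤ N) (hy : N * x ≤ 16) :
    densPos m N x ≤ 3888 / m ^ 2 := by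
  have hN0 : (0 : ℝ) < N := by exact_mod_cast (by omega : 0 < N)
  have hy0 : 0 < N * x := by positivity
  have hV : levelPos m N x = m ^ 2 / tanhHalf x * tanhHalf (N * x) := by
    rw [levelPos_eq hx]; simp [tanhHalf]
  have ht := tanhHalf_pos hx
  have hty := tanhHalf_pos hy0
  have hVN : N ≤ 9 / m ^ 2 * levelPos m N x := by
    have h1 := tanhHalf_le hx
    have h2 := div_two_add_le_tanhHalf hy0
    have h3 : N * x / 18 ≤ tanhHalf (N * x) := by
      refine le_trans ?_ h2
      gcongr
      linarith
    rw [hV, show 9 / m ^ 2 * (m ^ 2 / tanhHalf x * tanhHalf (N * x))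
      = 9 * tanhHalf (N * x) / tanhHalf x by field_simp, le_div_iff₀ ht]
    nlinarith
  have hV0 : 0 ≤ levelPos m N x := by rw [hV]; positivity
  obtain ⟨hr0, hr1⟩ := csch_ratio_le_one hx hN
  have h := mul_levelMean_le hV0 (mul_nonneg hV0 hr0) (mul_le_of_le_one_right hV0 hr1)
  have hK := kacDensity_le hx (by omega : 0 < N)
  have hL := levelMean_nonneg (levelPos m N x)
    (levelPos m N x * ((csch x - cschScaled N x) / (csch x + cschScaled N x)))
  unfold densPos
  set L := levelMean (levelPos m N x)
    (levelPos m N x * ((csch x - cschScaled N x) / (csch x + cschScaled N x)))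
  calc _ ≤ (9 / m ^ 2 * levelPos m N x) / 2 * L :=
        mul_le_mul_of_nonneg_right (hK.trans (by gcongr)) hL
    _ = 9 / (2 * m ^ 2) * (levelPos m N x * L) := by ring
    _ ≤ 9 / (2 * m ^ 2) * 864 := by gcongr
    _ = _ := by field_simp; norm_num

lemma abs_limNeg_sub_le (hx : 0 < x) : |limNeg m x - csch x / 2 / π| ≤ m ^ 2 / 8 := by
  have ht := tanhHalf_pos hx
  have hp0 : 0 < csch x / 2 := by linarith [csch_pos hx]
  have h := abs_levelMean_sub_one_div_pi_le (V := m ^ 2 * tanhHalf x) (W := m ^ 2 * tanhHalf x)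
    (by positivity) (by positivity)
  have hp := csch_mul_tanhHalf_le hx
  rw [limNeg, show csch x / 2 * levelMean (m ^ 2 * tanhHalf x) (m ^ 2 * tanhHalf x)
    - csch x / 2 / π = csch x / 2 * (levelMean (m ^ 2 * tanhHalf x) (m ^ 2 * tanhHalf x)
      - 1 / π) by ring, abs_mul, abs_of_pos hp0]
  calc _ ≤ csch x / 2 * ((m ^ 2 * tanhHalf x + m ^ 2 * tanhHalf x) / 4) := by gcongr
    _ = m ^ 2 / 2 * (csch x / 2 * tanhHalf x) := by ring
    _ ≤ m ^ 2 / 2 * (1 / 4) := by gcongr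
    _ = _ := by ring

lemma abs_densNeg_sub_le (hx : 0 < x) (hN : 32 ≤ N) (hy : N * x ≤ 16) :
    |densNeg m N x - kacDensity N x / π| ≤ 8 * m ^ 2 := by
  have hN0 : (0 : ℝ) < N := by exact_mod_cast (by omega : 0 < N)
  have hN32 : (32 : ℝ) ≤ N := by exact_mod_cast hN
  have hy0 : 0 < N * x := by positivity
  have hK0 := kacDensity_nonneg N x
  have ht := tanhHalf_pos hx
  have hty := tanhHalf_pos hy0
  have hK := kacDensity_le hx (by omega : 0 < N)
  have key : ∀ V W : ℝ, 0 ≤ V → 0 ≤ W → kacDensity N x * (V + W) ≤ 32 * m ^ 2 →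
      |kacDensity N x * levelMean V W - kacDensity N x / π| ≤ 8 * m ^ 2 := by
    intro V W hV hW h
    have := abs_levelMean_sub_one_div_pi_le hV hW
    rw [show kacDensity N x * levelMean V W - kacDensity N x / π
      = kacDensity N x * (levelMean V W - 1 / π) by ring, abs_mul, abs_of_nonneg hK0]
    calc _ ≤ kacDensity N x * ((V + W) / 4) := by gcongr
      _ ≤ _ := by linarith
  rcases Nat.even_or_odd N with he | ho
  · have hV : levelNeg m N x = m ^ 2 * tanhHalf x * tanhHalf (N * x) := by
      rw [levelNeg_eq]; simp [tanhHalf, he.neg_one_pow]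
    have h1 := tanhHalf_le hx
    have h2 := tanhHalf_le hy0
    have h3 := tanhHalf_le_one (N * x)
    have hP := csch_pos hx
    have hQ := cschScaled_pos hx (by omega : 0 < N)
    have hQP := cschScaled_lt hx (by omega : 2 ≤ N)
    rw [densNeg, he.neg_one_pow, one_mul]
    have hV0 : 0 ≤ levelNeg m N x := by rw [hV]; positivity
    apply key _ _ hV0 (mul_nonneg hV0 (div_nonneg (by linarith) (by linarith)))
    have hKV : kacDensity N x * levelNeg m N x ≤ 4 * m ^ 2 := by
      calc _ ≤ (N / 2 : ℝ) * (m ^ 2 * (x / 2) * 1) := by rw [hV]; gcongr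
        _ = m ^ 2 / 4 * (N * x) := by ring
        _ ≤ m ^ 2 / 4 * 16 := by gcongr
        _ = _ := by ring
    have hVx : levelNeg m N x * (csch x + cschScaled N x) ^ 2 ≤ m ^ 2 * N := by
      have h4 : csch x + cschScaled N x ≤ 2 / x := by
        have := csch_le_one_div hx
        rw [show 2 / x = 1 / x + 1 / x by ring]
        linarith
      calc _ ≤ (m ^ 2 * (x / 2) * (N * x / 2)) * (2 / x) ^ 2 := by rw [hV]; gcongr
        _ = _ := by field_simp
    set S := √(csch x ^ 2 - cschScaled N x ^ 2) with hS
    have hS2 : S ^ 2 = (csch x - cschScaled N x) * (csch x + cschScaled N x) := by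
      rw [hS, Real.sq_sqrt (by nlinarith)]; ring
    have hSN : N / 55 ≤ S := by
      apply Real.le_sqrt_of_sq_le
      refine le_trans ?_ (le_csch_sq_sub_cschScaled_sq hx (by omega : 0 < N))
      have h5 : (N : ℝ) ^ 2 / (3 + (N * x) ^ 2) ≥ N ^ 2 / 259 := by
        gcongr
        nlinarith
      nlinarith
    have hS0 : 0 < S := lt_of_lt_of_le (by positivity) hSN
    have hW : kacDensity N x * (levelNeg m N x
        * ((csch x + cschScaled N x) / (csch x - cschScaled N x))) ≤ 28 * m ^ 2 := by
      have h6 : kacDensity N x * (levelNeg m N x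
        * ((csch x + cschScaled N x) / (csch x - cschScaled N x)))
        = levelNeg m N x * (csch x + cschScaled N x) ^ 2 / (2 * S) := by
        rw [kacDensity, ← hS]
        have h7 : csch x - cschScaled N x ≠ 0 := by linarith
        rw [eq_div_iff (by positivity)]
        field_simp
        rw [hS2]
        ring
      rw [h6, div_le_iff₀ (by positivity)]
      nlinarith [sq_nonneg m]
    linarith
  · have hV : levelNeg m N x = m ^ 2 * tanhHalf x / tanhHalf (N * x) := by
      rw [levelNeg_eq]
      simp only [tanhHalf, ho.neg_one_pow]
      have : 1 - rexp (-(N * x)) ≠ 0 := by linarith [exp_neg_lt_one hy0]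
      field_simp
      ring
    obtain ⟨hr0, hr1⟩ := csch_ratio_le_one hx (by omega : 2 ≤ N)
    rw [densNeg, ho.neg_one_pow, neg_one_mul, sub_neg_eq_add, ← sub_eq_add_neg]
    have hV0 : 0 ≤ levelNeg m N x := by rw [hV]; positivity
    apply key _ _ hV0 (mul_nonneg hV0 hr0)
    have hVN : levelNeg m N x ≤ 9 * m ^ 2 / N := by
      have h1 := tanhHalf_le hx
      have h2 := div_two_add_le_tanhHalf hy0
      have h3 : N * x / 18 ≤ tanhHalf (N * x) := by
        refine le_trans ?_ h2
        gcongr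
        linarith
      rw [hV]
      calc _ ≤ m ^ 2 * (x / 2) / (N * x / 18) := by gcongr
        _ = _ := by field_simp; ring
    have := mul_le_of_le_one_right hV0 hr1
    calc _ ≤ (N / 2 : ℝ) * (9 * m ^ 2 / N + 9 * m ^ 2 / N) := by gcongr; linarith
      _ = 9 * m ^ 2 := by field_simp; ring
      _ ≤ _ := by nlinarith [sq_nonneg m]

lemma one_le_exp_four_mul (hy : N * x ≤ 16) : 1 ≤ rexp 4 * rexp (-(N * x) / 4) := by
  rw [← Real.exp_add]
  exact Real.one_le_exp (by linarith)

lemma abs_densPos_sub_limPos_le (hm : m ≠ 0) : ∃ C, 0 ≤ C ∧ ∀ N : ℕ, 32 ≤ N → ∀ x : ℝ, 0 < x →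
    |densPos m N x - limPos m x| ≤ C * rexp (-(N * x) / 4) := by
  refine ⟨20736 / m ^ 2 + 4104 / m ^ 2 * rexp 4, by positivity, fun N hN x hx => ?_⟩
  rcases le_total 16 (N * x) with hy | hy
  · refine (abs_densPos_sub_limPos_le_of_le hm hx (by omega) hy).trans ?_
    gcongr
    have : 0 ≤ 4104 / m ^ 2 * rexp 4 := by positivity
    linarith
  · have h1 := densPos_le hm hx (by omega) hy
    have h2 := limPos_le hm hx
    have h3 : |densPos m N x - limPos m x| ≤ 4104 / m ^ 2 := by
      have h4 := limPos_nonneg (m := m) hx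
      have h5 := densPos_nonneg (m := m) (N := N) (x := x)
      have : 4104 / m ^ 2 = 3888 / m ^ 2 + 216 / m ^ 2 := by ring
      rw [abs_le]
      constructor <;> linarith
    calc _ ≤ 4104 / m ^ 2 * 1 := by linarith
      _ ≤ 4104 / m ^ 2 * (rexp 4 * rexp (-(N * x) / 4)) := by
        gcongr; exact one_le_exp_four_mul hy
      _ = (4104 / m ^ 2 * rexp 4) * rexp (-(N * x) / 4) := by ring
      _ ≤ _ := by
        gcongr
        have : 0 ≤ 20736 / m ^ 2 := by positivity
        linarith

lemma abs_densNeg_sub_limNeg_le (m : ℝ) : ∃ C, 0 ≤ C ∧ ∀ N : ℕ, 32 ≤ N → ∀ x : ℝ, 0 < x →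
    |densNeg m N x - kacDensity N x / π - (limNeg m x - csch x / 2 / π)|
      ≤ C * rexp (-(N * x) / 4) := by
  refine ⟨17283 * m ^ 2 + 9 * m ^ 2 * rexp 4, by positivity, fun N hN x hx => ?_⟩
  rcases le_total 16 (N * x) with hy | hy
  · refine (abs_densNeg_sub_limNeg_le_of_le hx (by omega) hy).trans ?_
    gcongr
    have : 0 ≤ 9 * m ^ 2 * rexp 4 := by positivity
    linarith
  · have h1 := abs_densNeg_sub_le (m := m) hx hN hy
    have h2 := abs_limNeg_sub_le (m := m) hx
    have h3 := (abs_sub _ _).trans (add_le_add h1 h2)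
    calc _ ≤ 9 * m ^ 2 * 1 := by linarith [sq_nonneg m]
      _ ≤ 9 * m ^ 2 * (rexp 4 * rexp (-(N * x) / 4)) := by
        gcongr; exact one_le_exp_four_mul hy
      _ = (9 * m ^ 2 * rexp 4) * rexp (-(N * x) / 4) := by ring
      _ ≤ _ := by
        gcongr
        have : 0 ≤ 17283 * m ^ 2 := by positivity
        linarith

end DensityEstimates

section CentralDensity

open Filter Topology

lemma integral_Ioi_of_hasDerivAt_of_tendsto_nhdsGT {f f' : ℝ → ℝ} {a l r : ℝ}
    (hf : ∀ x ∈ Ioi a, HasDerivAt f (f' x) x) (hf' : IntegrableOn f' (Ioi a))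
    (hl : Tendsto f (𝓝[>] a) (𝓝 l)) (hr : Tendsto f atTop (𝓝 r)) :
    ∫ x in Ioi a, f' x = r - l := by
  have h := integral_Ioi_deriv_mul_eq_sub (u := f) (u' := f') (v := fun _ => 1) (v' := fun _ => 0)
    (a := a) (a' := l) (b' := r) hf (fun x _ => hasDerivAt_const x 1)
    (by convert hf' using 1; ext x; simp) (by convert hl using 1; ext x; simp)
    (by convert hr using 1; ext x; simp)
  simpa using h

lemma measurable_csch : Measurable csch := by
  unfold csch
  exact measurable_const.div Real.measurable_sinh

/-- The integrand of Kac's constant. -/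
noncomputable def kacConstIntegrand (y : ℝ) : ℝ := √(1 / y ^ 2 - csch y ^ 2) - 1 / (y + 1)

lemma integrableOn_of_abs_le_div_one_add_sq {f : ℝ → ℝ} (hf : Measurable f) {C : ℝ}
    (h : ∀ y, 0 < y → |f y| ≤ C / (1 + y ^ 2)) : IntegrableOn f (Ioi 0) := by
  refine Integrable.mono' ((integrable_inv_one_add_sq.const_mul C).integrableOn)
    hf.aestronglyMeasurable ?_
  refine (ae_restrict_iff' measurableSet_Ioi).2 (Eventually.of_forall fun y hy => ?_)
  simpa [div_eq_mul_inv] using h y hy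

lemma csch_le_div_cube {y : ℝ} (hy : 0 < y) : csch y ≤ 6 / y ^ 3 := by
  have h := add_cube_div_six_le_sinh hy.le
  have hs := sinh_pos_iff.2 hy
  unfold csch
  rw [div_le_div_iff₀ hs (by positivity)]
  linarith

lemma sqrt_one_div_sq_sub_le {y : ℝ} (hy : 0 < y) : √(1 / y ^ 2 - csch y ^ 2) ≤ 1 / y := by
  apply Real.sqrt_le_iff.2 ⟨by positivity, ?_⟩
  rw [div_pow, one_pow]
  nlinarith [sq_nonneg (csch y)]

lemma sub_le_sqrt_sq_sub_sq {a s : ℝ} (hs : 0 ≤ s) (h : s ≤ a) : a - s ≤ √(a ^ 2 - s ^ 2) := by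
  apply Real.le_sqrt_of_sq_le
  nlinarith

lemma abs_kacConstIntegrand_le {y : ℝ} (hy : 0 < y) :
    |kacConstIntegrand y| ≤ 14 / (1 + y ^ 2) := by
  unfold kacConstIntegrand
  have h0 := Real.sqrt_nonneg (1 / y ^ 2 - csch y ^ 2)
  rcases le_total y 1 with h1 | h1
  · have h2 : √(1 / y ^ 2 - csch y ^ 2) ≤ 1 :=
      Real.sqrt_le_one.2 (one_div_sq_sub_csch_sq_le hy)
    have h3 : 1 / (y + 1) ≤ 1 := by rw [div_le_one (by positivity)]; linarith
    have h4 : 0 < 1 / (y + 1) := by positivity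
    have h5 : 1 ≤ 14 / (1 + y ^ 2) := by rw [le_div_iff₀ (by positivity)]; nlinarith
    rw [abs_le]
    constructor <;> linarith
  · have h2 := sqrt_one_div_sq_sub_le hy
    have h3 := sub_le_sqrt_sq_sub_sq (csch_pos hy).le (csch_le_one_div hy)
    rw [div_pow, one_pow] at h3
    have h4 := csch_le_div_cube hy
    have h5 : 1 / y - 1 / (y + 1) = 1 / (y * (y + 1)) := by field_simp; ring
    have h6 : 1 / (y * (y + 1)) ≤ 1 / y ^ 2 :=
      one_div_le_one_div_of_le (by positivity) (by nlinarith)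
    have h7 : 6 / y ^ 3 ≤ 6 / y ^ 2 := by
      gcongr
      norm_num
    have h8 : 7 / y ^ 2 ≤ 14 / (1 + y ^ 2) := by
      rw [div_le_div_iff₀ (by positivity) (by positivity)]; nlinarith
    have h9 : 7 / y ^ 2 = 6 / y ^ 2 + 1 / y ^ 2 := by ring
    have h10 : 0 < 6 / y ^ 2 := by positivity
    have h11 : 0 < 1 / (y * (y + 1)) := by positivity
    have h12 : 0 < 1 / y ^ 2 := by positivity
    rw [abs_le]
    constructor <;> linarith

lemma integrableOn_kacConstIntegrand : IntegrableOn kacConstIntegrand (Ioi 0) := by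
  refine integrableOn_of_abs_le_div_one_add_sq ?_ fun y hy => abs_kacConstIntegrand_le hy
  unfold kacConstIntegrand
  have := measurable_csch
  fun_prop

variable {N : ℕ}

/-- The logarithmically divergent part of Kac's density. -/
noncomputable def logIntegrand (N : ℕ) (y : ℝ) : ℝ := csch (y / N) / N - 1 / y + 1 / (y + 1)

lemma one_div_sub_csch_div_le (hN : 0 < N) {y : ℝ} (hy : 0 < y) :
    1 / y - csch (y / N) / N ≤ y / N ^ 2 := by
  have hN0 : (0 : ℝ) < N := by exact_mod_cast hN
  have h := one_div_sub_csch_le (x := y / N) (by positivity)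
  calc 1 / y - csch (y / N) / N = (1 / (y / N) - csch (y / N)) / N := by field_simp
    _ ≤ y / N / N := by gcongr
    _ = _ := by field_simp

lemma csch_div_le (hN : 0 < N) {y : ℝ} (hy : 0 < y) : csch (y / N) / N ≤ 1 / y := by
  have hN0 : (0 : ℝ) < N := by exact_mod_cast hN
  have h := csch_le_one_div (x := y / N) (by positivity)
  rw [div_le_iff₀ hN0]
  refine h.trans (le_of_eq ?_)
  field_simp

lemma abs_logIntegrand_le (hN : 0 < N) {y : ℝ} (hy : 0 < y) :
    |logIntegrand N y| ≤ 14 * N ^ 2 / (1 + y ^ 2) := by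
  have hN1 : (1 : ℝ) ≤ N := by exact_mod_cast hN
  have hN2 : (1 : ℝ) ≤ (N : ℝ) ^ 2 := one_le_pow₀ hN1
  have h1 := csch_div_le hN hy
  have h4 : 0 < 1 / (y + 1) := by positivity
  unfold logIntegrand
  rcases le_total y 1 with hy1 | hy1
  · have h2 := one_div_sub_csch_div_le hN hy
    have h3 : y / N ^ 2 ≤ 1 := by rw [div_le_one (by positivity)]; linarith
    have h5 : 1 / (y + 1) ≤ 1 := by rw [div_le_one (by positivity)]; linarith
    have h6 : 1 ≤ 14 * (N : ℝ) ^ 2 / (1 + y ^ 2) := by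
      rw [le_div_iff₀ (by positivity)]; nlinarith
    rw [abs_le]
    constructor <;> linarith
  · have h2 := csch_pos (x := y / N) (by positivity)
    have h3 : csch (y / N) / N ≤ 6 * N ^ 2 / y ^ 2 := by
      have h5 := csch_le_div_cube (y := y / N) (by positivity)
      calc csch (y / N) / N ≤ 6 / (y / N) ^ 3 / N := by gcongr
        _ = 6 * N ^ 2 / y ^ 3 := by field_simp
        _ ≤ _ := by
          gcongr
          norm_num
    have h5 : 1 / y - 1 / (y + 1) = 1 / (y * (y + 1)) := by field_simp; ring
    have h6 : 1 / (y * (y + 1)) ≤ 1 / y ^ 2 :=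
      one_div_le_one_div_of_le (by positivity) (by nlinarith)
    have h7 : 1 / y ^ 2 ≤ 14 * N ^ 2 / (1 + y ^ 2) := by
      rw [div_le_div_iff₀ (by positivity) (by positivity)]; nlinarith
    have h8 : 6 * N ^ 2 / y ^ 2 ≤ 14 * N ^ 2 / (1 + y ^ 2) := by
      rw [div_le_div_iff₀ (by positivity) (by positivity)]
      have : 6 * (1 + y ^ 2) ≤ 14 * y ^ 2 := by nlinarith
      nlinarith [mul_le_mul_of_nonneg_left this (sq_nonneg (N : ℝ))]
    have h9 : 0 < csch (y / N) / N := by positivity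
    have h10 : 0 < 1 / (y * (y + 1)) := by positivity
    rw [abs_le]
    constructor <;> linarith

lemma integrableOn_logIntegrand (hN : 0 < N) : IntegrableOn (logIntegrand N) (Ioi 0) := by
  refine integrableOn_of_abs_le_div_one_add_sq ?_ fun y hy => abs_logIntegrand_le hN hy
  unfold logIntegrand
  have := measurable_csch
  fun_prop

lemma hasDerivAt_log_tanhHalf {x : ℝ} (hx : 0 < x) :
    HasDerivAt (fun x => log (tanhHalf x)) (csch x) x := by
  have h := exp_neg_lt_one hx
  have h0 : 1 - rexp (-x) ≠ 0 := by linarith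
  have h1 : 1 + rexp (-x) ≠ 0 := by positivity
  have he : HasDerivAt (fun x => rexp (-x)) (-rexp (-x)) x := by
    simpa using (hasDerivAt_neg x).exp
  have h2 := ((he.const_sub 1).fun_div (he.const_add 1) h1).log (div_ne_zero h0 h1)
  refine h2.congr_deriv ?_
  rw [csch_eq_exp x, show 1 - rexp (-x) ^ 2 = (1 - rexp (-x)) * (1 + rexp (-x)) by ring]
  field_simp
  ring

lemma tendsto_log_tanhHalf_atTop : Tendsto (fun x => log (tanhHalf x)) atTop (𝓝 0) := by
  have he : Tendsto (fun x : ℝ => rexp (-x)) atTop (𝓝 0) := tendsto_exp_neg_atTop_nhds_zero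
  have h : Tendsto tanhHalf atTop (𝓝 ((1 - 0) / (1 + 0))) :=
    (he.const_sub 1).div (he.const_add 1) (by norm_num)
  have := h.log (by norm_num)
  simpa using this

lemma tendsto_tanhHalf_div_nhdsGT : Tendsto (fun x => tanhHalf x / x) (𝓝[>] 0) (𝓝 (1 / 2)) := by
  have h1 : Tendsto (fun x : ℝ => 1 / (2 + x)) (𝓝[>] 0) (𝓝 (1 / 2)) := by
    have : ContinuousAt (fun x : ℝ => 1 / (2 + x)) 0 := by
      apply ContinuousAt.div <;> [fun_prop; fun_prop; norm_num]
    have h := this.tendsto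
    simp only [add_zero] at h
    exact h.mono_left nhdsWithin_le_nhds
  refine tendsto_of_tendsto_of_tendsto_of_le_of_le' h1 tendsto_const_nhds ?_ ?_
  · filter_upwards [self_mem_nhdsWithin] with x hx
    have hx : 0 < x := hx
    rw [le_div_iff₀ hx, one_div_mul_eq_div]
    exact div_two_add_le_tanhHalf hx
  · filter_upwards [self_mem_nhdsWithin] with x hx
    have hx : 0 < x := hx
    rw [div_le_iff₀ hx, one_div_mul_eq_div]
    exact tanhHalf_le hx

lemma integral_logIntegrand (hN : 0 < N) : ∫ y in Ioi 0, logIntegrand N y = log (2 * N) := by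
  have hN0 : (0 : ℝ) < N := by exact_mod_cast hN
  have hd : ∀ y ∈ Ioi (0 : ℝ), HasDerivAt (fun y => log (tanhHalf (y / N)) - log y + log (y + 1))
      (logIntegrand N y) y := by
    intro y hy
    have hy : 0 < y := hy
    have h1 := (hasDerivAt_log_tanhHalf (x := y / N) (by positivity)).comp y
      ((hasDerivAt_id y).div_const (N : ℝ))
    have h2 := ((hasDerivAt_id y).add_const 1).log (by simp; positivity)
    refine ((h1.sub (Real.hasDerivAt_log hy.ne')).add h2).congr_deriv ?_
    simp [logIntegrand, div_eq_mul_inv]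
  have hr : Tendsto (fun y => log (tanhHalf (y / N)) - log y + log (y + 1)) atTop (𝓝 0) := by
    have h1 := tendsto_log_tanhHalf_atTop.comp (tendsto_id.atTop_div_const hN0)
    have h2 : Tendsto (fun y : ℝ => log (1 + 1 / y)) atTop (𝓝 (log (1 + 0))) :=
      (Tendsto.const_add 1 (tendsto_const_nhds.div_atTop tendsto_id)).log (by norm_num)
    simp only [add_zero, log_one] at h2
    have h3 := h1.add h2
    rw [add_zero] at h3
    refine h3.congr' ?_
    filter_upwards [eventually_gt_atTop 0] with y hy
    have : 1 + 1 / y = (y + 1) / y := by field_simp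
    rw [this, Real.log_div (by positivity) hy.ne']
    simp
    ring
  have hl : Tendsto (fun y => log (tanhHalf (y / N)) - log y + log (y + 1)) (𝓝[>] 0)
      (𝓝 (-log (2 * N))) := by
    have h0 : Tendsto (fun y : ℝ => y / N) (𝓝[>] 0) (𝓝[>] 0) := by
      refine tendsto_nhdsWithin_iff.2 ⟨?_, ?_⟩
      · have : Continuous fun y : ℝ => y / N := by fun_prop
        have h := this.tendsto 0
        rw [zero_div] at h
        exact h.mono_left nhdsWithin_le_nhds
      · filter_upwards [self_mem_nhdsWithin] with y hy
        exact div_pos hy hN0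
    have h1 := ((tendsto_tanhHalf_div_nhdsGT.comp h0).div_const (N : ℝ)).log (by positivity)
    have h2 : Tendsto (fun y : ℝ => log (y + 1)) (𝓝[>] 0) (𝓝 (log (0 + 1))) :=
      ((tendsto_id.mono_left nhdsWithin_le_nhds).add_const 1).log (by norm_num)
    have h3 := h1.add h2
    have h4 : log (1 / 2 / N) + log (0 + 1) = -log (2 * N) := by
      rw [zero_add, log_one, add_zero, ← Real.log_inv]
      congr 1
      field_simp
    rw [h4] at h3
    refine h3.congr' ?_
    filter_upwards [self_mem_nhdsWithin] with y hy
    have hy : 0 < y := hy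
    have ht := tanhHalf_pos (x := y / N) (by positivity)
    rw [← Real.log_div ht.ne' hy.ne']
    congr 2
    simp only [Function.comp]
    field_simp
  rw [integral_Ioi_of_hasDerivAt_of_tendsto_nhdsGT hd (integrableOn_logIntegrand hN) hl hr]
  ring

lemma abs_sqrt_sub_sub_mul_sqrt_le {a b s : ℝ} (hs : 0 ≤ s) (hsa : s ≤ a) (hab : a ≤ b) :
    |√(a ^ 2 - s ^ 2) - a - (√(b ^ 2 - s ^ 2) - b)| * √(b ^ 2 - s ^ 2) ≤ 2 * s * (b - a) := by
  have h1 := sub_le_sqrt_sq_sub_sq hs hsa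
  have h2 := sub_le_sqrt_sq_sub_sq hs (hsa.trans hab)
  have hA := Real.sq_sqrt (show 0 ≤ a ^ 2 - s ^ 2 by nlinarith)
  have hF := Real.sq_sqrt (show 0 ≤ b ^ 2 - s ^ 2 by nlinarith)
  have hA0 := Real.sqrt_nonneg (a ^ 2 - s ^ 2)
  have hF0 := Real.sqrt_nonneg (b ^ 2 - s ^ 2)
  have hAa : √(a ^ 2 - s ^ 2) ≤ a := by
    apply Real.sqrt_le_iff.2 ⟨by linarith, by nlinarith⟩
  have hFb : √(b ^ 2 - s ^ 2) ≤ b := by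
    apply Real.sqrt_le_iff.2 ⟨by linarith, by nlinarith⟩
  set A := √(a ^ 2 - s ^ 2)
  set F := √(b ^ 2 - s ^ 2)
  have h3 : (A - a - (F - b)) * (F + A) = -((b - a) * ((b - F) + (a - A))) := by nlinarith
  calc |A - a - (F - b)| * F ≤ |A - a - (F - b)| * (F + A) := by gcongr; linarith
    _ = |(A - a - (F - b)) * (F + A)| := by rw [abs_mul, abs_of_nonneg (add_nonneg hF0 hA0)]
    _ = (b - a) * ((b - F) + (a - A)) := by
      rw [h3, abs_neg, abs_of_nonneg (mul_nonneg (by linarith) (by linarith))]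
    _ ≤ (b - a) * (s + s) :=
      mul_le_mul_of_nonneg_left (by linarith) (by linarith)
    _ = _ := by ring

/-- Kac's density in the variable `y = N x`. -/
noncomputable def kacScaled (N : ℕ) (y : ℝ) : ℝ := √((csch (y / N) / N) ^ 2 - csch y ^ 2)

lemma kacDensity_eq_kacScaled (hN : 0 < N) (x : ℝ) :
    kacDensity N x = N / 2 * kacScaled N (N * x) := by
  have hN0 : (0 : ℝ) < N := by exact_mod_cast hN
  rw [kacDensity, kacScaled, cschScaled_eq, mul_div_cancel_left₀ _ hN0.ne',
    show csch x ^ 2 - (N * csch (N * x)) ^ 2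
      = N ^ 2 * ((csch x / N) ^ 2 - csch (N * x) ^ 2) by field_simp,
    Real.sqrt_mul (sq_nonneg _), Real.sqrt_sq hN0.le]
  ring

lemma abs_kacScaled_sub_le (hN : 2 ≤ N) {y : ℝ} (hy : 0 < y) :
    |kacScaled N y - kacConstIntegrand y - logIntegrand N y| ≤ 64 / N ^ 2 * rexp (-1 / 2 * y) := by
  have hN0 : (0 : ℝ) < N := by exact_mod_cast (by omega : 0 < N)
  have hs := csch_pos hy
  have hsa : csch y ≤ csch (y / N) / N := by
    have h := (cschScaled_lt (x := y / N) (by positivity) hN).le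
    rw [cschScaled_eq, mul_div_cancel₀ _ hN0.ne'] at h
    rw [le_div_iff₀ hN0]
    linarith
  have hab := csch_div_le (by omega : 0 < N) hy
  have h := abs_sqrt_sub_sub_mul_sqrt_le hs.le hsa hab
  have h1 := one_div_sub_csch_div_le (by omega : 0 < N) hy
  rw [div_pow 1 y, one_pow] at h
  have hT : kacScaled N y - kacConstIntegrand y - logIntegrand N y
      = √((csch (y / N) / N) ^ 2 - csch y ^ 2) - csch (y / N) / N
        - (√(1 / y ^ 2 - csch y ^ 2) - 1 / y) := by
    unfold kacScaled kacConstIntegrand logIntegrand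
    ring
  rw [hT]
  set T := |√((csch (y / N) / N) ^ 2 - csch y ^ 2) - csch (y / N) / N
        - (√(1 / y ^ 2 - csch y ^ 2) - 1 / y)|
  have hT0 : 0 ≤ T := abs_nonneg _
  have h2 : 1 ≤ √(1 / y ^ 2 - csch y ^ 2) * (2 + y) := by
    have h3 : 1 / (2 + y) ≤ √(1 / y ^ 2 - csch y ^ 2) := by
      apply Real.le_sqrt_of_sq_le
      refine le_trans ?_ (le_one_div_sq_sub_csch_sq hy)
      rw [div_pow, one_pow]
      exact one_div_le_one_div_of_le (by positivity) (by nlinarith)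
    rwa [div_le_iff₀ (by positivity)] at h3
  have h4 := mul_csch_le hy
  have h5 : 1 + 2 * y ≤ 8 * rexp (y / 4) := by linarith [Real.add_one_le_exp (y / 4)]
  have h6 : 2 + y ≤ 4 * rexp (y / 4) := by linarith [Real.add_one_le_exp (y / 4)]
  calc T ≤ T * (√(1 / y ^ 2 - csch y ^ 2) * (2 + y)) := le_mul_of_one_le_right hT0 h2
    _ = T * √(1 / y ^ 2 - csch y ^ 2) * (2 + y) := by ring
    _ ≤ 2 * csch y * (1 / y - csch (y / N) / N) * (2 + y) := by gcongr
    _ ≤ 2 * csch y * (y / N ^ 2) * (2 + y) := by gcongr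
    _ = 2 / N ^ 2 * (y * csch y) * (2 + y) := by ring
    _ ≤ 2 / N ^ 2 * (8 * rexp (y / 4) * rexp (-y)) * (4 * rexp (y / 4)) := by
      have : y * csch y ≤ 8 * rexp (y / 4) * rexp (-y) := h4.trans (by gcongr)
      exact mul_le_mul (mul_le_mul_of_nonneg_left this (by positivity)) h6 (by positivity)
        (by positivity)
    _ = 64 / N ^ 2 * (rexp (y / 4) * rexp (-y) * rexp (y / 4)) := by ring
    _ = _ := by
      rw [← Real.exp_add, ← Real.exp_add]
      congr 2
      ring

lemma integrableOn_of_abs_le {f g : ℝ → ℝ} (hf : Measurable f) (hg : IntegrableOn g (Ioi 0))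
    (h : ∀ y, 0 < y → |f y| ≤ g y) : IntegrableOn f (Ioi 0) := by
  refine Integrable.mono' hg hf.aestronglyMeasurable ?_
  exact (ae_restrict_iff' measurableSet_Ioi).2 (Eventually.of_forall fun y hy => h y hy)

lemma abs_integral_le_of_abs_le {f g : ℝ → ℝ} (hg : IntegrableOn g (Ioi 0))
    (h : ∀ y, 0 < y → |f y| ≤ g y) : |∫ y in Ioi 0, f y| ≤ ∫ y in Ioi 0, g y :=
  norm_integral_le_of_norm_le (f := f) hg
    ((ae_restrict_iff' measurableSet_Ioi).2 (Eventually.of_forall fun y hy => h y hy))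

lemma measurable_kacDensity : Measurable (kacDensity N) := by
  unfold kacDensity
  simp only [cschScaled_eq]
  have := measurable_csch
  fun_prop

theorem integrableOn_kacDensity_and_abs_integral_sub_le (hN : 2 ≤ N) :
    IntegrableOn (kacDensity N) (Ioi 0) ∧
    |(∫ x in Ioi 0, kacDensity N x) - ((∫ y in Ioi 0, kacConstIntegrand y) + log (2 * N)) / 2|
      ≤ 64 / N ^ 2 := by
  have hNpos : 0 < N := by omega
  have hN0 : (0 : ℝ) < N := by exact_mod_cast hNpos
  have hexp := (integrableOn_exp_mul_Ioi (a := -1 / 2) (by norm_num) 0).const_mul (64 / (N : ℝ) ^ 2)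
  have hmeas : Measurable (kacScaled N) := by
    unfold kacScaled
    have := measurable_csch
    fun_prop
  have hJ := integrableOn_kacConstIntegrand
  have hL := integrableOn_logIntegrand hNpos
  have hR : IntegrableOn (fun y => kacScaled N y - kacConstIntegrand y - logIntegrand N y)
      (Ioi 0) := by
    refine integrableOn_of_abs_le ?_ hexp fun y hy => abs_kacScaled_sub_le hN hy
    have := measurable_csch
    unfold kacConstIntegrand logIntegrand
    fun_prop
  have hbound := abs_integral_le_of_abs_le hexp fun y hy => abs_kacScaled_sub_le hN hy
  have hS : IntegrableOn (kacScaled N) (Ioi 0) := by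
    refine ((hR.add hL).add hJ).congr_fun (fun y _ => ?_) measurableSet_Ioi
    simp
  have hint : ∫ y in Ioi 0, (kacScaled N y - kacConstIntegrand y - logIntegrand N y)
      = (∫ y in Ioi 0, kacScaled N y) - (∫ y in Ioi 0, kacConstIntegrand y) - log (2 * N) := by
    rw [← integral_logIntegrand hNpos, ← integral_sub hS hJ]
    exact integral_sub (hS.sub hJ) hL
  rw [hint, integral_const_mul, integral_exp_mul_Ioi (by norm_num)] at hbound
  have hK : kacDensity N = fun x => N / 2 * kacScaled N (N * x) :=
    funext fun x => kacDensity_eq_kacScaled hNpos x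
  constructor
  · rw [hK]
    refine Integrable.const_mul ?_ _
    have := (integrableOn_Ioi_comp_mul_left_iff (kacScaled N) 0 hN0).2 (by simpa using hS)
    exact this
  · rw [hK, integral_const_mul, integral_comp_mul_left_Ioi _ _ hN0, mul_zero, smul_eq_mul]
    have h1 : (N : ℝ) / 2 * ((N : ℝ)⁻¹ * ∫ y in Ioi 0, kacScaled N y)
        - ((∫ y in Ioi 0, kacConstIntegrand y) + log (2 * N)) / 2
        = ((∫ y in Ioi 0, kacScaled N y) - (∫ y in Ioi 0, kacConstIntegrand y)
          - log (2 * N)) / 2 := by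
      field_simp
      ring
    rw [h1, abs_div, abs_two]
    rw [mul_zero, Real.exp_zero] at hbound
    norm_num at hbound
    rw [show (64 : ℝ) / N ^ 2 = 64 / N ^ 2 * 2 / 2 by ring]
    gcongr

end CentralDensity

section ExponentialIntegral

open Filter Topology

lemma integral_log_mul_exp_neg :
    ∫ t in Ioi (0 : ℝ), log t * rexp (-t) = -eulerMascheroniConstant := by
  have h1 := Complex.hasDerivAt_GammaIntegral (s := 1) (by simp)
  have h2 : HasDerivAt Complex.GammaIntegral (-(eulerMascheroniConstant : ℂ)) 1 := by
    refine Complex.hasDerivAt_Gamma_one.congr_of_eventuallyEq ?_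
    have : ∀ᶠ s : ℂ in 𝓝 1, 0 < s.re :=
      Complex.continuous_re.continuousAt.eventually (lt_mem_nhds (by simp))
    filter_upwards [this] with s hs
    rw [Complex.Gamma_eq_integral hs]
  have h3 := h1.unique h2
  have h4 : ∫ t : ℝ in Ioi 0, (t : ℂ) ^ ((1 : ℂ) - 1) * (Real.log t * Real.exp (-t))
      = ((∫ t in Ioi (0 : ℝ), log t * rexp (-t) : ℝ) : ℂ) := by
    rw [← integral_complex_ofReal]
    simp
  rw [h4] at h3
  exact_mod_cast h3

lemma integrableOn_log_mul_exp_neg : IntegrableOn (fun t : ℝ => log t * rexp (-t)) (Ioi 0) := by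
  have h1 := Real.GammaIntegral_convergent (s := 2) (by norm_num)
  have h2 := (Real.GammaIntegral_convergent (s := 1 / 2) (by norm_num)).const_mul 2
  refine integrableOn_of_abs_le (by fun_prop) (h1.add h2) fun t ht => ?_
  have h3 : |log t| ≤ t ^ ((2 : ℝ) - 1) + 2 * t ^ ((1 : ℝ) / 2 - 1) := by
    have h4 := Real.log_le_sub_one_of_pos ht
    have h5 := Real.log_le_rpow_div (x := t⁻¹) (by positivity) (ε := 1 / 2) (by norm_num)
    rw [Real.log_inv, Real.inv_rpow ht.le, ← Real.rpow_neg ht.le] at h5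
    have h6 : t ^ ((2 : ℝ) - 1) = t := by norm_num
    have h7 : 0 < t ^ (-(1 / 2) : ℝ) := by positivity
    rw [h6, show (1 : ℝ) / 2 - 1 = -(1 / 2) by norm_num, abs_le]
    constructor <;> linarith
  rw [abs_mul, abs_of_pos (Real.exp_pos _)]
  simp only [Pi.add_apply]
  calc _ ≤ (t ^ ((2 : ℝ) - 1) + 2 * t ^ ((1 : ℝ) / 2 - 1)) * rexp (-t) := by gcongr
    _ = _ := by ring

/-- The antiderivative of `exp (-v) / v` on `(0, ∞)` vanishing at infinity. -/
noncomputable def expIntegral (v : ℝ) : ℝ :=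
  rexp (-v) * log v + eulerMascheroniConstant + ∫ t in (0 : ℝ)..v, log t * rexp (-t)

lemma intervalIntegrable_log_mul_exp_neg {v : ℝ} (hv : 0 < v) :
    IntervalIntegrable (fun t : ℝ => log t * rexp (-t)) volume 0 v := by
  rw [intervalIntegrable_iff_integrableOn_Ioc_of_le hv.le]
  exact integrableOn_log_mul_exp_neg.mono_set Ioc_subset_Ioi_self

lemma hasDerivAt_expIntegral {v : ℝ} (hv : 0 < v) :
    HasDerivAt expIntegral (rexp (-v) / v) v := by
  have h1 : HasDerivAt (fun v => ∫ t in (0 : ℝ)..v, log t * rexp (-t)) (log v * rexp (-v)) v := by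
    refine intervalIntegral.integral_hasDerivAt_right (intervalIntegrable_log_mul_exp_neg hv) ?_ ?_
    · exact (by fun_prop : Measurable fun t : ℝ =>
        log t * rexp (-t)).stronglyMeasurable.stronglyMeasurableAtFilter
    · exact (Real.continuousAt_log hv.ne').mul (by fun_prop)
  have he : HasDerivAt (fun x => rexp (-x)) (-rexp (-v)) v := by
    simpa using (hasDerivAt_neg v).exp
  refine (((he.mul (Real.hasDerivAt_log hv.ne')).add_const eulerMascheroniConstant).add
    h1).congr_deriv ?_
  field_simp
  ring

lemma tendsto_expIntegral_atTop : Tendsto expIntegral atTop (𝓝 0) := by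
  have h1 : Tendsto (fun v : ℝ => rexp (-v) * log v) atTop (𝓝 0) := by
    have h2 : Tendsto (fun v : ℝ => v ^ 1 * rexp (-v)) atTop (𝓝 0) :=
      Real.tendsto_pow_mul_exp_neg_atTop_nhds_zero 1
    refine squeeze_zero_norm' ?_ h2
    filter_upwards [eventually_ge_atTop 1] with v hv
    rw [Real.norm_eq_abs, abs_mul, abs_of_pos (Real.exp_pos _), abs_of_nonneg (Real.log_nonneg hv),
      pow_one, mul_comm]
    gcongr
    linarith [Real.log_le_sub_one_of_pos (by linarith : 0 < v)]
  have h3 := intervalIntegral_tendsto_integral_Ioi 0 integrableOn_log_mul_exp_neg tendsto_id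
  rw [integral_log_mul_exp_neg] at h3
  have h4 := (h1.add_const eulerMascheroniConstant).add h3
  rw [zero_add, add_neg_cancel] at h4
  exact h4

lemma tendsto_expIntegral_sub_log_nhdsGT :
    Tendsto (fun v => expIntegral v - log v) (𝓝[>] 0) (𝓝 eulerMascheroniConstant) := by
  have h1 : Tendsto (fun v : ℝ => (rexp (-v) - 1) * log v) (𝓝[>] 0) (𝓝 0) := by
    have h2 : Tendsto (fun v : ℝ => v * log v) (𝓝[>] 0) (𝓝 0) := by
      have := Real.continuous_mul_log.tendsto 0
      simp only [zero_mul] at this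
      exact this.mono_left nhdsWithin_le_nhds
    have h2' := h2.abs
    rw [abs_zero] at h2'
    refine squeeze_zero_norm' ?_ h2'
    filter_upwards [self_mem_nhdsWithin] with v hv
    have hv : 0 < v := hv
    rw [Real.norm_eq_abs, abs_mul, abs_mul, abs_of_pos hv]
    gcongr
    have h4 := Real.add_one_le_exp (-v)
    have h5 := exp_neg_lt_one hv
    rw [abs_le]
    constructor <;> linarith
  have h3 : Tendsto (fun v => ∫ t in (0 : ℝ)..v, log t * rexp (-t)) (𝓝[>] 0) (𝓝 0) := by
    have h4 : ContinuousOn (fun v => ∫ t in (0 : ℝ)..v, log t * rexp (-t)) (Icc 0 1) := by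
      have h5 : IntegrableOn (fun t => log t * rexp (-t)) (uIcc (0 : ℝ) 1) := by
        rw [uIcc_of_le zero_le_one, integrableOn_Icc_iff_integrableOn_Ioc]
        exact integrableOn_log_mul_exp_neg.mono_set Ioc_subset_Ioi_self
      have h6 := intervalIntegral.continuousOn_primitive_interval h5
      rwa [uIcc_of_le zero_le_one] at h6
    have h5 := (h4 0 (by simp)).tendsto
    simp only [intervalIntegral.integral_same] at h5
    rw [← nhdsWithin_Ioc_eq_nhdsGT (zero_lt_one' ℝ)]
    exact h5.mono_left (nhdsWithin_mono _ Ioc_subset_Icc_self)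
  have h4 := (h1.add_const eulerMascheroniConstant).add h3
  rw [zero_add, add_zero] at h4
  refine h4.congr fun v => ?_
  rw [expIntegral]
  ring

end ExponentialIntegral

section LimitingDensities

open Filter Topology

/-- An antiderivative of `levelMean V V / (2 V)` on `(0, ∞)`. -/
noncomputable def levelPrim (V : ℝ) : ℝ := expIntegral V / (2 * π) + normalMass √V ^ 2 / 4

lemma hasDerivAt_levelPrim {V : ℝ} (hV : 0 < V) :
    HasDerivAt levelPrim (levelMean V V / (2 * V)) V := by
  have h1 := ((hasDerivAt_normalMass √V).comp V (Real.hasDerivAt_sqrt hV.ne'))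
  refine (((hasDerivAt_expIntegral hV).div_const (2 * π)).add
    ((h1.pow 2).div_const 4)).congr_deriv ?_
  have h2 := two_mul_gaussianPDFReal_zero_one_sq √V
  have h3 : √V ^ 2 = V := Real.sq_sqrt hV.le
  have h4 : 0 < √V := Real.sqrt_pos.2 hV
  rw [h3] at h2
  have h5 : rexp (-V) = π * (2 * gaussianPDFReal 0 1 √V ^ 2) := by
    rw [h2]
    field_simp
  rw [levelMean, absMean, h5]
  simp only [Function.comp_apply]
  generalize √V = s at *
  subst h3
  field_simp
  ring

lemma tendsto_levelPrim_atTop : Tendsto levelPrim atTop (𝓝 (1 / 4)) := by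
  have h1 := (tendsto_normalMass_atTop.comp Real.tendsto_sqrt_atTop).pow 2
  have h2 := (tendsto_expIntegral_atTop.div_const (2 * π)).add (h1.div_const 4)
  rw [zero_div, zero_add, one_pow] at h2
  exact h2

lemma tendsto_levelPrim_sub_log_nhdsGT :
    Tendsto (fun V => levelPrim V - log V / (2 * π)) (𝓝[>] 0)
      (𝓝 (eulerMascheroniConstant / (2 * π))) := by
  have h1 : Tendsto (fun V => normalMass √V ^ 2 / 4) (𝓝[>] 0) (𝓝 0) := by
    have hc : Continuous normalMass :=
      continuous_iff_continuousAt.2 fun x => (hasDerivAt_normalMass x).continuousAt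
    have h2 : Continuous fun V => normalMass √V ^ 2 / 4 := by fun_prop
    have h3 := h2.tendsto 0
    simp only [Real.sqrt_zero, normalMass_zero, ne_eq, OfNat.ofNat_ne_zero, not_false_eq_true,
      zero_pow, zero_div] at h3
    exact h3.mono_left nhdsWithin_le_nhds
  have h2 := (tendsto_expIntegral_sub_log_nhdsGT.div_const (2 * π)).add h1
  rw [add_zero] at h2
  refine h2.congr fun V => ?_
  rw [levelPrim]
  ring

lemma hasDerivAt_tanhHalf {x : ℝ} (hx : 0 < x) :
    HasDerivAt tanhHalf (tanhHalf x * csch x) x := by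
  have h := (hasDerivAt_log_tanhHalf hx).exp
  rw [Real.exp_log (tanhHalf_pos hx)] at h
  refine h.congr_of_eventuallyEq ?_
  filter_upwards [lt_mem_nhds hx] with y hy
  rw [Real.exp_log (tanhHalf_pos hy)]

lemma tendsto_tanhHalf_nhdsGT : Tendsto tanhHalf (𝓝[>] 0) (𝓝[>] 0) := by
  refine tendsto_nhdsWithin_iff.2 ⟨?_, ?_⟩
  · have h : ContinuousAt tanhHalf 0 := by
      unfold tanhHalf
      refine ContinuousAt.div (by fun_prop) (by fun_prop) (by positivity)
    have h2 := h.tendsto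
    rw [show tanhHalf 0 = 0 by simp [tanhHalf]] at h2
    exact h2.mono_left nhdsWithin_le_nhds
  · filter_upwards [self_mem_nhdsWithin] with x hx
    exact tanhHalf_pos hx

lemma tendsto_tanhHalf_atTop : Tendsto tanhHalf atTop (𝓝 1) := by
  have h := (Real.continuous_exp.tendsto 0).comp tendsto_log_tanhHalf_atTop
  rw [Real.exp_zero] at h
  refine h.congr' ?_
  filter_upwards [eventually_gt_atTop 0] with x hx
  exact Real.exp_log (tanhHalf_pos hx)

lemma measurable_levelMean : Measurable fun p : ℝ × ℝ => levelMean p.1 p.2 := by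
  have h1 := continuous_gaussianPDFReal_zero_one
  have h2 := continuous_absMean
  have : Continuous fun p : ℝ × ℝ => levelMean p.1 p.2 := by
    unfold levelMean
    fun_prop
  exact this.measurable

lemma measurable_tanhHalf : Measurable tanhHalf := by
  unfold tanhHalf
  fun_prop

lemma measurable_limPos (m : ℝ) : Measurable (limPos m) := by
  have h1 := measurable_csch
  have h2 := measurable_tanhHalf
  have h3 : Measurable fun x => (m ^ 2 / tanhHalf x, m ^ 2 / tanhHalf x) := by fun_prop
  have h4 := measurable_levelMean.comp h3
  unfold limPos
  exact (h1.div_const 2).mul h4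

lemma measurable_limNeg (m : ℝ) : Measurable (limNeg m) := by
  have h1 := measurable_csch
  have h2 := measurable_tanhHalf
  have h3 : Measurable fun x => (m ^ 2 * tanhHalf x, m ^ 2 * tanhHalf x) := by fun_prop
  have h4 := measurable_levelMean.comp h3
  unfold limNeg
  exact (h1.div_const 2).mul h4

lemma levelMean_self_le {V : ℝ} (hV : 0 ≤ V) : levelMean V V ≤ 1 / 2 := by
  have h1 := levelMean_le hV hV
  have h2 := Real.add_one_le_exp (V / 2)
  have h3 : rexp (-V / 2) * rexp (V / 2) = 1 := by
    rw [← Real.exp_add, neg_div, neg_add_cancel, Real.exp_zero]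
  nlinarith [Real.exp_pos (-V / 2)]

lemma abs_le_div_one_add_sq_of_csch {A B y z : ℝ} (hy : 0 < y) (hA : |z| ≤ A)
    (hB : |z| ≤ B * csch y) : |z| ≤ (2 * A + 12 * B) / (1 + y ^ 2) := by
  have hA0 : 0 ≤ A := (abs_nonneg z).trans hA
  have hc := csch_pos hy
  have hB0 : 0 ≤ B := by
    by_contra! h
    nlinarith [abs_nonneg z]
  rw [le_div_iff₀ (by positivity)]
  rcases le_total y 1 with h | h
  · have : 1 + y ^ 2 ≤ 2 := by nlinarith
    nlinarith [abs_nonneg z]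
  · have h1 := csch_le_div_cube hy
    have h2 : csch y * (1 + y ^ 2) ≤ 12 := by
      have : 6 / y ^ 3 * (1 + y ^ 2) ≤ 12 := by
        rw [div_mul_eq_mul_div, div_le_iff₀ (by positivity)]
        nlinarith [mul_nonneg (sub_nonneg.2 h) (sq_nonneg y), sq_nonneg (y-1)]
      nlinarith
    nlinarith [sq_nonneg y]

lemma limPos_le_csch {m x : ℝ} (hx : 0 < x) : limPos m x ≤ 1 / 2 * csch x := by
  have h1 := csch_pos hx
  have h2 := tanhHalf_pos hx
  have h3 := levelMean_self_le (V := m ^ 2 / tanhHalf x) (by positivity)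
  unfold limPos
  nlinarith

lemma integrableOn_limPos {m : ℝ} (hm : m ≠ 0) : IntegrableOn (limPos m) (Ioi 0) :=
  integrableOn_of_abs_le_div_one_add_sq (measurable_limPos m) fun y hy => by
    have h := limPos_nonneg (m := m) hy
    exact abs_le_div_one_add_sq_of_csch hy (by rw [abs_of_nonneg h]; exact limPos_le hm hy)
      (by rw [abs_of_nonneg h]; exact limPos_le_csch hy)

lemma integrableOn_limNeg_sub (m : ℝ) :
    IntegrableOn (fun x => limNeg m x - csch x / 2 / π) (Ioi 0) :=
  integrableOn_of_abs_le_div_one_add_sq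
    ((measurable_limNeg m).sub ((measurable_csch.div_const 2).div_const π)) fun y hy => by
    refine abs_le_div_one_add_sq_of_csch (B := 1 / 2) hy (abs_limNeg_sub_le hy) ?_
    have h1 := csch_pos hy
    have h2 := tanhHalf_pos hy
    have h3 := levelMean_self_le (V := m ^ 2 * tanhHalf y) (by positivity)
    have h4 := levelMean_nonneg (m ^ 2 * tanhHalf y) (m ^ 2 * tanhHalf y)
    have h5 : csch y / 2 / π ≤ 1 / 2 * csch y := by
      rw [div_le_iff₀ Real.pi_pos]
      nlinarith [Real.pi_gt_three]
    have h6 : 0 ≤ csch y / 2 / π := by positivity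
    unfold limNeg
    rw [abs_le]
    constructor <;> nlinarith

lemma integral_limPos {m : ℝ} (hm : m ≠ 0) :
    ∫ x in Ioi 0, limPos m x = 1 / 4 - levelPrim (m ^ 2) := by
  have hm2 : 0 < m ^ 2 := by positivity
  have h0 : Tendsto (fun x => m ^ 2 / tanhHalf x) (𝓝[>] 0) atTop :=
    (tendsto_inv_nhdsGT_zero.comp tendsto_tanhHalf_nhdsGT).const_mul_atTop hm2
  have h1 : Tendsto (fun x => m ^ 2 / tanhHalf x) atTop (𝓝 (m ^ 2)) := by
    have h := (tendsto_const_nhds (x := m ^ 2)).div tendsto_tanhHalf_atTop one_ne_zero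
    rwa [div_one] at h
  have h := integral_Ioi_of_hasDerivAt_of_tendsto_nhdsGT (a := 0)
    (f := fun x => -levelPrim (m ^ 2 / tanhHalf x)) (f' := limPos m) ?_ (integrableOn_limPos hm)
    (tendsto_levelPrim_atTop.comp h0).neg
    ((hasDerivAt_levelPrim hm2).continuousAt.tendsto.comp h1).neg
  · rw [h]
    ring
  · intro x hx
    have ht := tanhHalf_pos hx
    have hd := (hasDerivAt_levelPrim (V := m ^ 2 / tanhHalf x) (by positivity)).comp x
      (((hasDerivAt_tanhHalf hx).inv ht.ne').const_mul (m ^ 2))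
    refine hd.neg.congr_deriv ?_
    unfold limPos
    field_simp

lemma integral_limNeg_sub {m : ℝ} (hm : m ≠ 0) :
    ∫ x in Ioi 0, (limNeg m x - csch x / 2 / π)
      = levelPrim (m ^ 2) - (eulerMascheroniConstant + log (m ^ 2)) / (2 * π) := by
  have hm2 : 0 < m ^ 2 := by positivity
  have h0 : Tendsto (fun x => m ^ 2 * tanhHalf x) (𝓝[>] 0) (𝓝[>] 0) := by
    refine tendsto_nhdsWithin_iff.2 ⟨?_, ?_⟩
    · simpa using (tendsto_nhdsWithin_iff.1 tendsto_tanhHalf_nhdsGT).1.const_mul (m ^ 2)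
    · filter_upwards [self_mem_nhdsWithin] with x hx
      exact mul_pos hm2 (tanhHalf_pos hx)
  have h1 : Tendsto (fun x => m ^ 2 * tanhHalf x) atTop (𝓝 (m ^ 2)) := by
    simpa using tendsto_tanhHalf_atTop.const_mul (m ^ 2)
  have hl : Tendsto (fun x => levelPrim (m ^ 2 * tanhHalf x) - log (tanhHalf x) / (2 * π))
      (𝓝[>] 0) (𝓝 (eulerMascheroniConstant / (2 * π) + log (m ^ 2) / (2 * π))) := by
    refine ((tendsto_levelPrim_sub_log_nhdsGT.comp h0).add_const _).congr' ?_
    filter_upwards [self_mem_nhdsWithin] with x hx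
    simp only [Function.comp_apply]
    rw [Real.log_mul hm2.ne' (tanhHalf_pos hx).ne']
    ring
  have h := integral_Ioi_of_hasDerivAt_of_tendsto_nhdsGT (a := 0)
    (f := fun x => levelPrim (m ^ 2 * tanhHalf x) - log (tanhHalf x) / (2 * π))
    (f' := fun x => limNeg m x - csch x / 2 / π) ?_ (integrableOn_limNeg_sub m) hl
    (((hasDerivAt_levelPrim hm2).continuousAt.tendsto.comp h1).sub
      (tendsto_log_tanhHalf_atTop.div_const (2 * π)))
  · rw [h]
    ring
  · intro x hx
    have ht := tanhHalf_pos hx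
    have hd := (hasDerivAt_levelPrim (V := m ^ 2 * tanhHalf x) (by positivity)).comp x
      ((hasDerivAt_tanhHalf hx).const_mul (m ^ 2))
    refine (hd.sub ((hasDerivAt_log_tanhHalf hx).div_const (2 * π))).congr_deriv ?_
    unfold limNeg
    field_simp

end LimitingDensities

section Asymptotics

open Filter Topology

lemma measurable_cschScaled (N : ℕ) : Measurable (cschScaled N) := by
  unfold cschScaled
  fun_prop

lemma measurable_densPos (m : ℝ) (N : ℕ) : Measurable (densPos m N) := by
  have h1 := measurable_csch
  have h2 := measurable_cschScaled N
  have hV : Measurable (levelPos m N) := by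
    unfold levelPos
    fun_prop
  have h3 : Measurable fun x => (levelPos m N x,
    levelPos m N x * ((csch x - cschScaled N x) / (csch x + cschScaled N x))) := by fun_prop
  have h4 := measurable_levelMean.comp h3
  exact measurable_kacDensity.mul h4

lemma measurable_densNeg (m : ℝ) (N : ℕ) : Measurable (densNeg m N) := by
  have h1 := measurable_csch
  have h2 := measurable_cschScaled N
  have hV : Measurable (levelNeg m N) := by
    unfold levelNeg
    fun_prop
  have h3 : Measurable fun x => (levelNeg m N x, levelNeg m N x *
    ((csch x + (-1) ^ N * cschScaled N x) / (csch x - (-1) ^ N * cschScaled N x))) := by fun_prop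
  have h4 := measurable_levelMean.comp h3
  exact measurable_kacDensity.mul h4

lemma integrableOn_const_mul_exp (C : ℝ) {N : ℕ} (hN : 0 < N) :
    IntegrableOn (fun x : ℝ => C * rexp (-(N * x) / 4)) (Ioi 0) ∧
      ∫ x in Ioi (0 : ℝ), C * rexp (-(N * x) / 4) = 4 * C / N := by
  have hN' : (0 : ℝ) < N := by exact_mod_cast hN
  have ha : -(N : ℝ) / 4 < 0 := by linarith
  have he : (fun x : ℝ => C * rexp (-(N * x) / 4)) = fun x => C * rexp (-(N : ℝ) / 4 * x) := by
    ext x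
    ring_nf
  rw [he]
  refine ⟨(integrableOn_exp_mul_Ioi ha 0).const_mul C, ?_⟩
  rw [integral_const_mul, integral_exp_mul_Ioi ha, mul_zero, Real.exp_zero]
  field_simp

lemma integrableOn_and_abs_integral_sub_le {f g : ℝ → ℝ} {C : ℝ} {N : ℕ} (hN : 0 < N)
    (hf : Measurable f) (hgm : Measurable g) (hg : IntegrableOn g (Ioi 0))
    (h : ∀ x, 0 < x → |f x - g x| ≤ C * rexp (-(N * x) / 4)) :
    IntegrableOn f (Ioi 0) ∧
      |(∫ x in Ioi 0, f x) - ∫ x in Ioi 0, g x| ≤ 4 * C / N := by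
  obtain ⟨h1, h2⟩ := integrableOn_const_mul_exp C hN
  have h3 : IntegrableOn (fun x => f x - g x) (Ioi 0) := integrableOn_of_abs_le (hf.sub hgm) h1 h
  have h4 : IntegrableOn f (Ioi 0) := by
    refine (h3.add hg).congr_fun (fun x _ => ?_) measurableSet_Ioi
    simp
  refine ⟨h4, ?_⟩
  rw [← integral_sub h4 hg, ← h2]
  exact abs_integral_le_of_abs_le h1 h

lemma lintegral_ofReal_eq {f : ℝ → ℝ} (hf : IntegrableOn f (Ioi 0))
    (h : ∀ x, 0 < x → 0 ≤ f x) :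
    ∫⁻ x in Ioi 0, ENNReal.ofReal (f x) = ENNReal.ofReal (∫ x in Ioi 0, f x) :=
  (ofReal_integral_eq_lintegral_ofReal hf
    ((ae_restrict_mem measurableSet_Ioi).mono fun x hx => h x hx)).symm

lemma kacConstIntegrand_eq (x : ℝ) :
    √(1 / x ^ 2 - 4 * rexp (-2 * x) / (1 - rexp (-2 * x)) ^ 2) - 1 / (x + 1)
      = kacConstIntegrand x := by
  have h : 4 * rexp (-2 * x) / (1 - rexp (-2 * x)) ^ 2 = csch x ^ 2 := by
    have h1 : rexp (-2 * x) = rexp (-x) ^ 2 := by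
      rw [← Real.exp_nat_mul]
      ring_nf
    rw [csch_eq_exp x, h1, div_pow, mul_pow]
    norm_num
  rw [kacConstIntegrand, h]

lemma exists_abs_integral_dens_sub_le {m : ℝ} (hm : m ≠ 0) :
    ∃ C, 0 ≤ C ∧ ∀ N : ℕ, 32 ≤ N →
      IntegrableOn (densPos m N) (Ioi 0) ∧ IntegrableOn (densNeg m N) (Ioi 0) ∧
      |2 * (∫ x in Ioi 0, densPos m N x) + 2 * (∫ x in Ioi 0, densNeg m N x)
        - (1 / π * log N + (log 2 + ∫ y in Ioi 0, kacConstIntegrand y) / π + 1 / 2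
          - eulerMascheroniConstant / π - 2 / π * log |m|)| ≤ C / N := by
  obtain ⟨A, hA0, hA⟩ := abs_densPos_sub_limPos_le hm
  obtain ⟨B, hB0, hB⟩ := abs_densNeg_sub_limNeg_le m
  refine ⟨8 * A + 8 * B + 128, by positivity, fun N hN => ?_⟩
  have hN0 : 0 < N := by omega
  have hN1 : (1 : ℝ) ≤ N := by exact_mod_cast hN0
  obtain ⟨hP, hP'⟩ := integrableOn_and_abs_integral_sub_le hN0 (measurable_densPos m N)
    (measurable_limPos m) (integrableOn_limPos hm) (hA N hN)
  obtain ⟨hK, hK'⟩ := integrableOn_kacDensity_and_abs_integral_sub_le (N := N) (by omega)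
  have hL := integrableOn_limNeg_sub m
  obtain ⟨hQ, hQ'⟩ := integrableOn_and_abs_integral_sub_le (C := B) hN0 (measurable_densNeg m N)
    ((measurable_kacDensity.div_const π).add
      ((measurable_limNeg m).sub ((measurable_csch.div_const 2).div_const π)))
    ((hK.div_const π).add hL)
    (fun x hx => by
      have h := hB N hN x hx
      rwa [sub_sub] at h)
  refine ⟨hP, hQ, ?_⟩
  have hsum : ∫ x in Ioi 0, (kacDensity N x / π + (limNeg m x - csch x / 2 / π))
      = (∫ x in Ioi 0, kacDensity N x) / π
        + ∫ x in Ioi 0, (limNeg m x - csch x / 2 / π) := by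
    rw [integral_add (hK.div_const π) hL, integral_div]
  simp only [Pi.add_apply, Pi.sub_apply] at hQ'
  rw [hsum, integral_limNeg_sub hm] at hQ'
  rw [integral_limPos hm] at hP'
  have hlog : log (m ^ 2) = 2 * log |m| := by
    rw [← sq_abs, Real.log_pow]
    norm_num
  rw [Real.log_mul (by norm_num) (by positivity)] at hK'
  rw [hlog] at hQ'
  have h64 : 64 / (N : ℝ) ^ 2 ≤ 64 / N := by
    gcongr
    nlinarith
  have hKπ : |((∫ x in Ioi 0, kacDensity N x)
      - ((∫ y in Ioi 0, kacConstIntegrand y) + (log 2 + log N)) / 2) / π| ≤ 64 / N := by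
    rw [abs_div, abs_of_pos Real.pi_pos]
    refine (div_le_self (abs_nonneg _) (by linarith [Real.pi_gt_three])).trans (hK'.trans h64)
  have hC : (8 * A + 8 * B + 128) / (N : ℝ) = 2 * (4 * A / N) + 2 * (4 * B / N) + 2 * (64 / N) := by
    ring
  rw [hC]
  generalize (∫ x in Ioi 0, kacDensity N x) = k at *
  generalize (∫ y in Ioi 0, kacConstIntegrand y) = J at *
  generalize (∫ x in Ioi 0, densPos m N x) = p at *
  generalize (∫ x in Ioi 0, densNeg m N x) = q at *
  have hid : 2 * p + 2 * q - (1 / π * log N + (log 2 + J) / π + 1 / 2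
        - eulerMascheroniConstant / π - 2 / π * log |m|)
      = 2 * (p - (1 / 4 - levelPrim (m ^ 2)))
        + 2 * (q - (k / π + (levelPrim (m ^ 2)
          - (eulerMascheroniConstant + 2 * log |m|) / (2 * π))))
        + 2 * ((k - (J + (log 2 + log N)) / 2) / π) := by
    field_simp
    ring
  rw [hid]
  refine (abs_add_three _ _ _).trans ?_
  simp only [abs_mul, Nat.abs_ofNat]
  linarith

end Asymptotics

/-- Theorem 5.3: if the coefficients of a degree-`n` random polynomial are iid normals
with mean `μ`, standard deviation `σ > 0`, and `m = μ/σ ≠ 0`, then the expected number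
`Eₙ` of real zeros satisfies
`Eₙ = (1/π) log n + C₁/2 + 1/2 - γ/π - (2/π) log|m| + O(1/n)`,
where `C₁` is the constant of Theorem 2.2 and `γ` is Euler's constant. -/
theorem noncentral_kac_asymptotics (μ σ : ℝ) (hσ : 0 < σ) (m : ℝ) (hm : m = μ / σ)
    (hm0 : m ≠ 0) (E : ℕ → ℝ) (hEpos : ∀ n, 0 ≤ E n)
    (hE : ∀ n : ℕ,
      ∫⁻ a : Fin (n + 1) → ℝ,
          ({t : ℝ | ∑ i : Fin (n + 1), a i * t ^ (i : ℕ) = 0}.encard : ℝ≥0∞)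
          ∂(Measure.pi fun _ => gaussianReal μ (Real.toNNReal (σ ^ 2)))
        = ENNReal.ofReal (E n))
    (C₁ : ℝ)
    (hC₁ : C₁ = (2 / π) * (Real.log 2 +
      ∫ x in Set.Ioi (0 : ℝ),
        (Real.sqrt (1 / x ^ 2
            - 4 * Real.exp (-2 * x) / (1 - Real.exp (-2 * x)) ^ 2) - 1 / (x + 1)))) :
    ∃ (K : ℝ) (N : ℕ), ∀ n ≥ N,
      |E n - ((1 / π) * Real.log n + C₁ / 2 + 1 / 2
        - Real.eulerMascheroniConstant / π - (2 / π) * Real.log |m|)|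
      ≤ K / n := by
  subst hm
  obtain ⟨C, hC0, hC⟩ := exists_abs_integral_dens_sub_le hm0
  refine ⟨C + 1, 32, fun n hn => ?_⟩
  obtain ⟨hP, hQ, h⟩ := hC (n + 1) (by omega)
  have hp : 0 ≤ ∫ x in Ioi 0, densPos (μ / σ) (n + 1) x :=
    setIntegral_nonneg measurableSet_Ioi fun x _ => densPos_nonneg
  have hq : 0 ≤ ∫ x in Ioi 0, densNeg (μ / σ) (n + 1) x :=
    setIntegral_nonneg measurableSet_Ioi fun x _ => densNeg_nonneg
  have hEn : E n = 2 * (∫ x in Ioi 0, densPos (μ / σ) (n + 1) x)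
      + 2 * ∫ x in Ioi 0, densNeg (μ / σ) (n + 1) x := by
    have h1 := hE n
    rw [lintegral_encard_zeros_rescale μ σ hσ n, lintegral_encard_zeros_eq_dens _ (by omega),
      lintegral_ofReal_eq hP fun _ _ => densPos_nonneg,
      lintegral_ofReal_eq hQ fun _ _ => densNeg_nonneg, ← ENNReal.ofReal_ofNat 2,
      ← ENNReal.ofReal_mul (by norm_num), ← ENNReal.ofReal_mul (by norm_num),
      ← ENNReal.ofReal_add (by positivity) (by positivity),
      ENNReal.ofReal_eq_ofReal_iff (by positivity) (hEpos n)] at h1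
    exact h1.symm
  rw [setIntegral_congr_fun measurableSet_Ioi fun x _ => kacConstIntegrand_eq x] at hC₁
  have hn0 : (32 : ℝ) ≤ n := by exact_mod_cast hn
  have hn1 : (0 : ℝ) < n := by linarith
  have hlog1 : log n ≤ log (n + 1 : ℕ) := by
    refine Real.log_le_log hn1 ?_
    push_cast
    linarith
  have hlog2 : log (n + 1 : ℕ) - log n ≤ 1 / n := by
    rw [← Real.log_div (by positivity) hn1.ne']
    refine (Real.log_le_sub_one_of_pos (by positivity)).trans (le_of_eq ?_)
    push_cast
    field_simp
    ring
  have hlog3 : |1 / π * (log (n + 1 : ℕ) - log n)| ≤ 1 / n := by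
    rw [abs_of_nonneg (mul_nonneg (by positivity) (by linarith)), one_div_mul_eq_div]
    exact (div_le_self (by linarith) (by linarith [Real.pi_gt_three])).trans hlog2
  have hCn : C / (n + 1 : ℕ) ≤ C / n := by
    gcongr
    linarith
  rw [← hEn] at h
  have hid : E n - (1 / π * log n + C₁ / 2 + 1 / 2 - eulerMascheroniConstant / π
        - 2 / π * log |μ / σ|)
      = (E n - (1 / π * log (n + 1 : ℕ) + (log 2 + ∫ y in Ioi 0, kacConstIntegrand y) / π + 1 / 2
          - eulerMascheroniConstant / π - 2 / π * log |μ / σ|))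
        + 1 / π * (log (n + 1 : ℕ) - log n) := by
    rw [hC₁]
    ring
  rw [hid, add_div C]
  refine (abs_add_le _ _).trans ?_
  linarith
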